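/- arXiv:2503.03082 — 8 statements merged into one kernel-verified Lean document; each statement's English description precedes it below -/
import Mathlib

section
/- Sequential combinations and reverse sequential combinations of GABCS rules are linear mappings. Precisely: (i) given for each i ≤ k a scoring function s_i : 2^𝒜 × C_i → ℝ, define 𝒮_0 = {∅} and, for i = 1,…,k, 𝒮_i(P) = argmax{ Σ_{A∈P} s_i(A, M∪{a}) : M ∈ 𝒮_{i−1}(P), a ∈ 𝒜∖M }; then the mapping P ↦ 𝒮_k(P) is linear. (ii) Given for each i ≤ m−k a scoring function s_i : 2^𝒜 × C_{m−i} → ℝ, define 𝒮_0 = {𝒜} and, for i = 1,…,m−k, 𝒮_i(P) = argmax{ Σ_{A∈P} s_i(A, M∖{a}) : M ∈ 𝒮_{i−1}(P), a ∈ M }; then the mapping P ↦ 𝒮_{m−k}(P) is linear. -/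
/-- The histogram of a profile dotted with a hyperplane vector. -/
noncomputable def histDot {E : Type*} [Fintype E] [DecidableEq E]
    (P : List E) (h : E → ℝ) : ℝ :=
  ∑ e, (P.count e : ℝ) * h e

/-- A mapping from profiles to a decision space `D` is linear if it factors through
the signs of finitely many hyperplanes applied to the histogram of the profile. -/
def IsLinearMapping {E : Type*} [Fintype E] [DecidableEq E] {D : Type*}
    (f : List E → D) : Prop :=
  ∃ (K : ℕ) (h : Fin K → E → ℝ) (g : (Fin K → SignType) → D),
    ∀ P : List E, f P = g fun j => SignType.sign (histDot P (h j))

/-- Score of committee `W` at profile `P` under the `i`-th scoring function. -/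
def seqScore {m : ℕ} (s : ℕ → Finset (Fin m) → Finset (Fin m) → ℝ) (i : ℕ)
    (P : List (Finset (Fin m))) (W : Finset (Fin m)) : ℝ :=
  (P.map fun A => s i A W).sum

/-- The sequential combination of GABCS rules: `𝒮_0 = {∅}` and
`𝒮_i = argmax { score_i(P, M ∪ {a}) : M ∈ 𝒮_{i-1}, a ∉ M }`. -/
def seqS {m : ℕ} (s : ℕ → Finset (Fin m) → Finset (Fin m) → ℝ) :
    ℕ → List (Finset (Fin m)) → Set (Finset (Fin m))
  | 0, _ => {∅}
  | i + 1, P =>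
      {W | ∃ M ∈ seqS s i P, ∃ a, a ∉ M ∧ W = insert a M ∧
        ∀ M' ∈ seqS s i P, ∀ a', a' ∉ M' →
          seqScore s (i + 1) P (insert a' M') ≤ seqScore s (i + 1) P W}

/-- The reverse sequential combination of GABCS rules: `𝒮_0 = {𝒜}` and
`𝒮_i = argmax { score_i(P, M ∖ {a}) : M ∈ 𝒮_{i-1}, a ∈ M }`. -/
def revS {m : ℕ} (s : ℕ → Finset (Fin m) → Finset (Fin m) → ℝ) :
    ℕ → List (Finset (Fin m)) → Set (Finset (Fin m))
  | 0, _ => {Finset.univ}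
  | i + 1, P =>
      {W | ∃ M ∈ revS s i P, ∃ a, a ∈ M ∧ W = M.erase a ∧
        ∀ M' ∈ revS s i P, ∀ a', a' ∈ M' →
          seqScore s (i + 1) P (M'.erase a') ≤ seqScore s (i + 1) P W}

theorem histDot_eq_sum_map {E : Type*} [Fintype E] [DecidableEq E] (P : List E) (h : E → ℝ) :
    histDot P h = (P.map h).sum := by
  induction P with
  | nil => simp [histDot]
  | cons a P ih =>
    rw [List.map_cons, List.sum_cons, ← ih]
    simp [histDot, List.count_cons, add_mul, Finset.sum_add_distrib, add_comm]

theorem isLinearMapping_of_finite {E : Type*} [Fintype E] [DecidableEq E] {D ι : Type*} [Finite ι]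
    {f : List E → D} (h : ι → E → ℝ)
    (hf : ∀ P Q : List E,
      (∀ j, SignType.sign (histDot P (h j)) = SignType.sign (histDot Q (h j))) → f P = f Q) :
    IsLinearMapping f := by
  classical
  obtain ⟨K, ⟨e⟩⟩ := Finite.exists_equiv_fin ι
  refine ⟨K, fun j => h (e.symm j), fun σ =>
    if hσ : ∃ P : List E, σ = fun j => SignType.sign (histDot P (h (e.symm j)))
    then f hσ.choose else f [], fun P => ?_⟩
  have hP : ∃ Q : List E, (fun j => SignType.sign (histDot P (h (e.symm j)))) =
      fun j => SignType.sign (histDot Q (h (e.symm j))) := ⟨P, rfl⟩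
  simp only [dif_pos hP]
  refine hf _ _ fun j => ?_
  simpa using congrFun hP.choose_spec (e j)

theorem histDot_score_sub {m : ℕ} (s : ℕ → Finset (Fin m) → Finset (Fin m) → ℝ) (i : ℕ)
    (P : List (Finset (Fin m))) (V W : Finset (Fin m)) :
    histDot P (fun A => s i A V - s i A W) = seqScore s i P V - seqScore s i P W := by
  rw [histDot_eq_sum_map, seqScore, seqScore]
  induction P with
  | nil => simp
  | cons A P ih => simp only [List.map_cons, List.sum_cons, ih]; ring

/-- A mapping that depends only on how finitely many scoring functions compare committees
is linear. -/
theorem isLinearMapping_of_seqScore_le_iff {m : ℕ} {D : Type*}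
    (s : ℕ → Finset (Fin m) → Finset (Fin m) → ℝ) (n : ℕ) {f : List (Finset (Fin m)) → D}
    (hf : ∀ P Q : List (Finset (Fin m)),
      (∀ i ≤ n, ∀ V W, seqScore s i P V ≤ seqScore s i P W ↔
        seqScore s i Q V ≤ seqScore s i Q W) → f P = f Q) :
    IsLinearMapping f := by
  refine isLinearMapping_of_finite
    (fun j : Fin (n + 1) × Finset (Fin m) × Finset (Fin m) =>
      fun A => s j.1 A j.2.1 - s j.1 A j.2.2) fun P Q hPQ => hf P Q fun i hi V W => ?_
  have key := hPQ (⟨i, Nat.lt_succ_of_le hi⟩, V, W)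
  simp only [histDot_score_sub] at key
  rw [← sub_nonpos, ← sub_nonpos (a := seqScore s i Q V), ← sign_nonpos_iff, key, sign_nonpos_iff]

theorem seqS_congr {m : ℕ} (s : ℕ → Finset (Fin m) → Finset (Fin m) → ℝ)
    {P Q : List (Finset (Fin m))} (n : ℕ)
    (h : ∀ i ≤ n, ∀ V W, seqScore s i P V ≤ seqScore s i P W ↔
      seqScore s i Q V ≤ seqScore s i Q W) : seqS s n P = seqS s n Q := by
  induction n with
  | zero => rfl
  | succ n ih =>
    simp only [seqS, ih fun i hi => h i (hi.trans n.le_succ), h (n + 1) le_rfl]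

theorem revS_congr {m : ℕ} (s : ℕ → Finset (Fin m) → Finset (Fin m) → ℝ)
    {P Q : List (Finset (Fin m))} (n : ℕ)
    (h : ∀ i ≤ n, ∀ V W, seqScore s i P V ≤ seqScore s i P W ↔
      seqScore s i Q V ≤ seqScore s i Q W) : revS s n P = revS s n Q := by
  induction n with
  | zero => rfl
  | succ n ih =>
    simp only [revS, ih fun i hi => h i (hi.trans n.le_succ), h (n + 1) le_rfl]

/-- sequential combinations and reverse sequential combinations of
GABCS rules are linear mappings. -/
theorem sequential_isLinear (m k : ℕ) (hm : 1 ≤ m) (hk1 : 1 ≤ k) (hkm : k ≤ m)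
    (s s' : ℕ → Finset (Fin m) → Finset (Fin m) → ℝ) :
    IsLinearMapping (fun P => seqS s k P) ∧
    IsLinearMapping (fun P => revS s' (m - k) P) := by
  exact ⟨isLinearMapping_of_seqScore_le_iff s k fun _ _ => seqS_congr s k,
    isLinearMapping_of_seqScore_le_iff s' (m - k) fun _ _ => revS_congr s' (m - k)⟩
end

section
/- Each of the axioms CORE, JR, PJR, EJR, PJR+, EJR+, and FJR is a group-satisfaction-threshold (GST) axiom: for each axiom X in this list there exists a threshold function τ : C_k × 2^{2^𝒜} → {0,1,…,k+1} such that for every approval profile P of n ≥ 1 agents and every k-committee W, W satisfies X at P if and only if for every family of preferences G ⊆ 2^𝒜, the number of agents in P whose approval set lies in G is strictly less than τ(W,G)·n/k. -/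
/-- An approval preference over `m` alternatives. -/
abbrev Pref (m : ℕ) := Finset (Fin m)

/-- An approval profile: a finite tuple of approval preferences. -/
abbrev Profile (m : ℕ) := List (Pref m)

/-- Intersection of a list of approval sets (`univ` for the empty list). -/
def interList {m : ℕ} : List (Pref m) → Pref m
  | [] => Finset.univ
  | A :: rest => A ∩ interList rest

/-- Union of a list of approval sets. -/
def unionList {m : ℕ} : List (Pref m) → Pref m
  | [] => ∅
  | A :: rest => A ∪ unionList rest

/-- `P'` is an `ℓ`-cohesive subgroup of `P` (w.r.t. committee size `k`):
`P' ⊆ P`, `|P'| ≥ ℓ·n/k`, and the voters in `P'` approve at least `ℓ` common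
alternatives. -/
def Cohesive {m : ℕ} (k : ℕ) (P P' : Profile m) (ℓ : ℕ) : Prop :=
  P'.Sublist P ∧ ℓ * P.length ≤ P'.length * k ∧ ℓ ≤ (interList P').card

/-- Justified representation. -/
def SatJR {m : ℕ} (k : ℕ) (P : Profile m) (W : Pref m) : Prop :=
  ∀ P' : Profile m, Cohesive k P P' 1 → ∃ A ∈ P', 1 ≤ (A ∩ W).card

/-- Extended justified representation. -/
def SatEJR {m : ℕ} (k : ℕ) (P : Profile m) (W : Pref m) : Prop :=
  ∀ ℓ : ℕ, 1 ≤ ℓ → ∀ P' : Profile m, Cohesive k P P' ℓ → ∃ A ∈ P', ℓ ≤ (A ∩ W).card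

/-- Proportional justified representation. -/
def SatPJR {m : ℕ} (k : ℕ) (P : Profile m) (W : Pref m) : Prop :=
  ∀ ℓ : ℕ, 1 ≤ ℓ → ∀ P' : Profile m, Cohesive k P P' ℓ → ℓ ≤ (W ∩ unionList P').card

/-- EJR+. -/
def SatEJRplus {m : ℕ} (k : ℕ) (P : Profile m) (W : Pref m) : Prop :=
  ¬ ∃ a : Fin m, a ∉ W ∧ ∃ ℓ : ℕ, 1 ≤ ℓ ∧ ℓ ≤ k ∧ ∃ P' : Profile m,
    P'.Sublist P ∧ ℓ * P.length ≤ P'.length * k ∧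
    ∀ A ∈ P', a ∈ A ∧ (A ∩ W).card < ℓ

/-- PJR+. -/
def SatPJRplus {m : ℕ} (k : ℕ) (P : Profile m) (W : Pref m) : Prop :=
  ¬ ∃ a : Fin m, a ∉ W ∧ ∃ ℓ : ℕ, 1 ≤ ℓ ∧ ℓ ≤ k ∧ ∃ P' : Profile m,
    P'.Sublist P ∧ ℓ * P.length ≤ P'.length * k ∧
    (∀ A ∈ P', a ∈ A) ∧ (unionList P' ∩ W).card < ℓ

/-- Fully justified representation. -/
def SatFJR {m : ℕ} (k : ℕ) (P : Profile m) (W : Pref m) : Prop :=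
  ¬ ∃ β : ℕ, 1 ≤ β ∧ ∃ T : Pref m, ∃ P' : Profile m,
    P' ≠ [] ∧ P'.Sublist P ∧ T.card * P.length ≤ P'.length * k ∧
    (∀ A ∈ P', β ≤ (A ∩ T).card) ∧ ∀ A ∈ P', (A ∩ W).card < β

/-- Core stability. -/
def SatCORE {m : ℕ} (k : ℕ) (P : Profile m) (W : Pref m) : Prop :=
  ∀ (P' : Profile m) (W' : Pref m), P' ≠ [] → P'.Sublist P →
    W'.card * P.length ≤ P'.length * k →
    ∃ A ∈ P', (A ∩ W').card ≤ (A ∩ W).card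

/-- Number of agents in `P` whose approval set lies in the family `G`. -/
def countIn {m : ℕ} (P : Profile m) (G : Finset (Pref m)) : ℕ :=
  P.countP fun A => decide (A ∈ G)

/-- `X` is a group-satisfaction-threshold (GST) axiom: there is a threshold function
`τ : C_k × 2^{2^𝒜} → {0,…,k+1}` such that for every profile with at least one agent
and every `k`-committee `W`, `W` satisfies `X` iff for every family `G` of
preferences, the number of agents with preference in `G` is less than `τ(W,G)·n/k`. -/
def IsGSTAxiom (m k : ℕ) (X : Profile m → Pref m → Prop) : Prop :=
  ∃ τ : Pref m → Finset (Pref m) → ℕ,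
    (∀ W G, τ W G ≤ k + 1) ∧
    ∀ (P : Profile m) (W : Pref m), 1 ≤ P.length → W.card = k →
      (X P W ↔ ∀ G : Finset (Pref m), countIn P G * k < τ W G * P.length)

/-- The intersection of a list of preferences depends only on its set of members. -/
theorem interList_eq_inf {m : ℕ} (l : Profile m) : interList l = l.toFinset.inf id := by
  induction l with
  | nil => rfl
  | cons A l ih => simp [interList, ih]

/-- The union of a list of preferences depends only on its set of members. -/
theorem unionList_eq_sup {m : ℕ} (l : Profile m) : unionList l = l.toFinset.sup id := by
  induction l with
  | nil => rfl
  | cons A l ih => simp [unionList, ih]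

theorem ne_nil_of_entitled {m k ℓ : ℕ} {P P' : Profile m} (hP : 1 ≤ P.length) (hℓ : 1 ≤ ℓ)
    (h : ℓ * P.length ≤ P'.length * k) : P' ≠ [] := by
  rintro rfl
  have := Nat.mul_pos hℓ hP
  simp only [List.length_nil, zero_mul] at h
  omega

/-- An axiom is a GST axiom if its violations are the groups of voters that are entitled to `ℓ ≥ 1`
seats and whose set of preferences satisfies a condition `Bad W ℓ`
that is inherited by subfamilies. -/
theorem IsGSTAxiom.of_violation {m k : ℕ} {X : Profile m → Pref m → Prop}
    (Bad : Pref m → ℕ → Finset (Pref m) → Prop)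
    (anti : ∀ W ℓ G H, G ⊆ H → Bad W ℓ H → Bad W ℓ G)
    (hX : ∀ (P : Profile m) (W : Pref m), 1 ≤ P.length → (X P W ↔
      ∀ ℓ, 1 ≤ ℓ → ∀ P' : Profile m, P'.Sublist P → ℓ * P.length ≤ P'.length * k →
        ¬ Bad W ℓ P'.toFinset)) :
    IsGSTAxiom m k X := by
  let S (W : Pref m) (G : Finset (Pref m)) : Set ℕ := {ℓ | ℓ = k + 1 ∨ 1 ≤ ℓ ∧ Bad W ℓ G}
  have memS (W G) : k + 1 ∈ S W G := Or.inl rfl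
  refine ⟨fun W G => sInf (S W G), fun W G => Nat.sInf_le (memS W G), fun P W hP _ => ?_⟩
  rw [hX P W hP]
  constructor
  · intro h G
    by_contra! hG
    rcases Nat.sInf_mem ⟨_, memS W G⟩ with heq | ⟨hpos, hbad⟩
    · rw [heq] at hG
      have hle : countIn P G ≤ P.length := List.countP_le_length
      have := Nat.mul_le_mul_right k hle
      nlinarith
    · refine h _ hpos (P.filter fun A => decide (A ∈ G)) List.filter_sublist ?_
        (anti _ _ _ G ?_ hbad)
      · rwa [← List.countP_eq_length_filter]
      · intro A hA
        simpa using (List.mem_filter.1 (List.mem_toFinset.1 hA)).2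
  · intro h ℓ hℓ P' hsub hent hbad
    have hτ : sInf (S W P'.toFinset) ≤ ℓ := Nat.sInf_le (Or.inr ⟨hℓ, hbad⟩)
    have hcount : P'.length ≤ countIn P P'.toFinset := by
      have hself : P'.countP (fun A => decide (A ∈ P'.toFinset)) = P'.length :=
        List.countP_eq_length.2 fun A hA => by simpa using hA
      exact hself ▸ hsub.countP_le
    have hlt : countIn P P'.toFinset * k < sInf (S W P'.toFinset) * P.length := h _
    have := Nat.mul_le_mul_right P.length hτ
    have := Nat.mul_le_mul_right k hcount
    omega

theorem isGSTAxiom_SatCORE (m k : ℕ) : IsGSTAxiom m k (SatCORE k) := by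
  refine .of_violation
    (fun W ℓ G => ∃ W' : Pref m, W'.card = ℓ ∧ ∀ A ∈ G, (A ∩ W).card < (A ∩ W').card)
    (fun W ℓ G H hGH ⟨W', h, h'⟩ => ⟨W', h, fun A hA => h' A (hGH hA)⟩) fun P W hP => ?_
  constructor
  · rintro h ℓ hℓ P' hsub hent ⟨W', rfl, hW'⟩
    obtain ⟨A, hA, hle⟩ := h P' W' (ne_nil_of_entitled hP hℓ hent) hsub hent
    exact (hW' A (List.mem_toFinset.2 hA)).not_ge hle
  · intro h P' W' hne hsub hent
    by_contra! hlt
    obtain ⟨A, hA⟩ := List.exists_mem_of_ne_nil P' hne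
    have hpos : 1 ≤ W'.card :=
      (Nat.zero_lt_of_lt (hlt A hA)).trans_le (Finset.card_le_card Finset.inter_subset_right)
    exact h _ hpos P' hsub hent ⟨W', rfl, fun A hA => hlt A (List.mem_toFinset.1 hA)⟩

theorem isGSTAxiom_SatJR (m k : ℕ) : IsGSTAxiom m k (SatJR k) := by
  refine .of_violation
    (fun W ℓ G => ℓ = 1 ∧ 1 ≤ (G.inf id).card ∧ ∀ A ∈ G, (A ∩ W).card < 1)
    (fun W ℓ G H hGH ⟨h₁, h, h'⟩ => ⟨h₁, h.trans (Finset.card_le_card (Finset.inf_mono hGH)),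
      fun A hA => h' A (hGH hA)⟩) fun P W hP => ?_
  constructor
  · rintro h _ _ P' hsub hent ⟨rfl, hint, hlt⟩
    obtain ⟨A, hA, hle⟩ := h P' ⟨hsub, hent, by rwa [interList_eq_inf]⟩
    exact (hlt A (List.mem_toFinset.2 hA)).not_ge hle
  · rintro h P' ⟨hsub, hent, hint⟩
    by_contra! hlt
    exact h 1 le_rfl P' hsub hent
      ⟨rfl, interList_eq_inf P' ▸ hint, fun A hA => hlt A (List.mem_toFinset.1 hA)⟩

theorem isGSTAxiom_SatPJR (m k : ℕ) : IsGSTAxiom m k (SatPJR k) := by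
  refine .of_violation
    (fun W ℓ G => ℓ ≤ (G.inf id).card ∧ (W ∩ G.sup id).card < ℓ)
    (fun W ℓ G H hGH ⟨h, h'⟩ => ⟨h.trans (Finset.card_le_card (Finset.inf_mono hGH)),
      (Finset.card_le_card (Finset.inter_subset_inter_left (Finset.sup_mono hGH))).trans_lt h'⟩)
    fun P W hP => ?_
  simp only [SatPJR, Cohesive, interList_eq_inf, unionList_eq_sup, not_and, not_lt, and_imp]

theorem isGSTAxiom_SatEJR (m k : ℕ) : IsGSTAxiom m k (SatEJR k) := by
  refine .of_violation
    (fun W ℓ G => ℓ ≤ (G.inf id).card ∧ ∀ A ∈ G, (A ∩ W).card < ℓ)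
    (fun W ℓ G H hGH ⟨h, h'⟩ => ⟨h.trans (Finset.card_le_card (Finset.inf_mono hGH)),
      fun A hA => h' A (hGH hA)⟩) fun P W hP => ?_
  simp only [SatEJR, Cohesive, interList_eq_inf, List.mem_toFinset, not_and, not_forall, not_lt,
    exists_prop, and_imp]

theorem isGSTAxiom_SatPJRplus (m k : ℕ) : IsGSTAxiom m k (SatPJRplus k) := by
  refine .of_violation
    (fun W ℓ G => ℓ ≤ k ∧ ∃ a ∉ W, (∀ A ∈ G, a ∈ A) ∧ (G.sup id ∩ W).card < ℓ)
    (fun W ℓ G H hGH ⟨hk, a, ha, h, h'⟩ => ⟨hk, a, ha, fun A hA => h A (hGH hA),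
      (Finset.card_le_card (Finset.inter_subset_inter_right (Finset.sup_mono hGH))).trans_lt h'⟩)
    fun P W hP => ?_
  constructor
  · rintro h ℓ hℓ P' hsub hent ⟨hk, a, ha, hall, hlt⟩
    exact h ⟨a, ha, ℓ, hℓ, hk, P', hsub, hent, fun A hA => hall A (List.mem_toFinset.2 hA),
      by rwa [unionList_eq_sup]⟩
  · rintro h ⟨a, ha, ℓ, hℓ, hk, P', hsub, hent, hall, hlt⟩
    exact h ℓ hℓ P' hsub hent ⟨hk, a, ha, fun A hA => hall A (List.mem_toFinset.1 hA),
      unionList_eq_sup P' ▸ hlt⟩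

theorem isGSTAxiom_SatEJRplus (m k : ℕ) : IsGSTAxiom m k (SatEJRplus k) := by
  refine .of_violation
    (fun W ℓ G => ℓ ≤ k ∧ ∃ a ∉ W, ∀ A ∈ G, a ∈ A ∧ (A ∩ W).card < ℓ)
    (fun W ℓ G H hGH ⟨hk, a, ha, h⟩ => ⟨hk, a, ha, fun A hA => h A (hGH hA)⟩) fun P W hP => ?_
  constructor
  · rintro h ℓ hℓ P' hsub hent ⟨hk, a, ha, hall⟩
    exact h ⟨a, ha, ℓ, hℓ, hk, P', hsub, hent, fun A hA => hall A (List.mem_toFinset.2 hA)⟩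
  · rintro h ⟨a, ha, ℓ, hℓ, hk, P', hsub, hent, hall⟩
    exact h ℓ hℓ P' hsub hent ⟨hk, a, ha, fun A hA => hall A (List.mem_toFinset.1 hA)⟩

theorem isGSTAxiom_SatFJR (m k : ℕ) : IsGSTAxiom m k (SatFJR k) := by
  refine .of_violation
    (fun W ℓ G => ∃ β : ℕ, 1 ≤ β ∧ ∃ T : Pref m, T.card = ℓ ∧
      ∀ A ∈ G, β ≤ (A ∩ T).card ∧ (A ∩ W).card < β)
    (fun W ℓ G H hGH ⟨β, hβ, T, hT, h⟩ => ⟨β, hβ, T, hT, fun A hA => h A (hGH hA)⟩)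
    fun P W hP => ?_
  constructor
  · rintro h ℓ hℓ P' hsub hent ⟨β, hβ, T, rfl, hall⟩
    exact h ⟨β, hβ, T, P', ne_nil_of_entitled hP hℓ hent, hsub, hent,
      fun A hA => (hall A (List.mem_toFinset.2 hA)).1,
      fun A hA => (hall A (List.mem_toFinset.2 hA)).2⟩
  · rintro h ⟨β, hβ, T, P', hne, hsub, hent, hle, hlt⟩
    obtain ⟨A, hA⟩ := List.exists_mem_of_ne_nil P' hne
    have hpos : 1 ≤ T.card :=
      hβ.trans ((hle A hA).trans (Finset.card_le_card Finset.inter_subset_right))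
    exact h _ hpos P' hsub hent ⟨β, hβ, T, rfl, fun A hA =>
      ⟨hle A (List.mem_toFinset.1 hA), hlt A (List.mem_toFinset.1 hA)⟩⟩

/-- CORE, JR, PJR, EJR, PJR+, EJR+, and FJR are all GST axioms. -/
theorem axioms_are_GST (m k : ℕ) (hm : 1 ≤ m) (hk : 1 ≤ k) (hkm : k ≤ m) :
    IsGSTAxiom m k (SatCORE k) ∧ IsGSTAxiom m k (SatJR k) ∧
    IsGSTAxiom m k (SatPJR k) ∧ IsGSTAxiom m k (SatEJR k) ∧
    IsGSTAxiom m k (SatPJRplus k) ∧ IsGSTAxiom m k (SatEJRplus k) ∧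
    IsGSTAxiom m k (SatFJR k) :=
  ⟨isGSTAxiom_SatCORE m k, isGSTAxiom_SatJR m k, isGSTAxiom_SatPJR m k, isGSTAxiom_SatEJR m k,
    isGSTAxiom_SatPJRplus m k, isGSTAxiom_SatEJRplus m k, isGSTAxiom_SatFJR m k⟩
end

section
/- Linearity is preserved under the intersection, equality-test, and refinement-test operations: if f_1 and f_2 are linear mappings from profiles over a finite preference space ℰ to subsets of a finite set D̊, then the mappings f_1 ∩ f_2 (defined by (f_1 ∩ f_2)(P) = f_1(P) ∩ f_2(P)), f_1 =? f_2 (defined to equal f_1(P) if f_1(P) = f_2(P) and ∅ otherwise), and f_1 ⊆? f_2 (defined to equal f_1(P) if f_1(P) ⊆ f_2(P) and ∅ otherwise) are all linear. -/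
/-- Combining two linear mappings pointwise by an arbitrary binary operation on decisions
gives a linear mapping. -/
theorem IsLinearMapping.map₂ {E : Type*} [Fintype E] [DecidableEq E] {D₁ D₂ D₃ : Type*}
    {f₁ : List E → D₁} {f₂ : List E → D₂} (h₁ : IsLinearMapping f₁) (h₂ : IsLinearMapping f₂)
    (op : D₁ → D₂ → D₃) : IsLinearMapping fun P => op (f₁ P) (f₂ P) := by
  obtain ⟨K₁, v₁, g₁, hg₁⟩ := h₁
  obtain ⟨K₂, v₂, g₂, hg₂⟩ := h₂
  refine ⟨K₁ + K₂, Fin.append v₁ v₂,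
    fun s => op (g₁ fun j => s (Fin.castAdd K₂ j)) (g₂ fun j => s (Fin.natAdd K₁ j)), ?_⟩
  intro P
  simp only [hg₁, hg₂, Fin.append_left, Fin.append_right]

/-- linearity is preserved under intersection (`f₁ ∩ f₂`), the
equality test (`f₁ =? f₂`, equal to `f₁ P` when `f₁ P = f₂ P` and `∅` otherwise),
and the refinement test (`f₁ ⊆? f₂`, equal to `f₁ P` when `f₁ P ⊆ f₂ P` and `∅`
otherwise). -/
theorem operations_preserve_linearity (E : Type*) [Fintype E] [DecidableEq E]
    (D : Type*) [Fintype D] (f₁ f₂ : List E → Set D)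
    (h₁ : IsLinearMapping f₁) (h₂ : IsLinearMapping f₂) :
    IsLinearMapping (fun P => f₁ P ∩ f₂ P) ∧
    IsLinearMapping (fun P => {d | d ∈ f₁ P ∧ f₁ P = f₂ P}) ∧
    IsLinearMapping (fun P => {d | d ∈ f₁ P ∧ f₁ P ⊆ f₂ P}) :=
  ⟨h₁.map₂ h₂ fun A B => A ∩ B,
    h₁.map₂ h₂ fun A B => {d | d ∈ A ∧ A = B},
    h₁.map₂ h₂ fun A B => {d | d ∈ A ∧ A ⊆ B}⟩
end

section
/- The Natarajan dimension of any family of parameterized maximizers with η parameters is at most η: let D̊ be a finite nonempty set, let ψ be a function assigning to each profile P and each d ∈ D̊ a vector ψ(P,d) ∈ ℝ^η, and for w ∈ ℝ^η define f_w(P) = { d ∈ D̊ : ψ(P,d)·w ≥ ψ(P,d′)·w for all d′ ∈ D̊ }. Then Ndim({ f_w : w ∈ ℝ^η }) ≤ η. -/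
/-- A set `S` of profiles is (Natarajan-)shattered by a family `F` of functions:
there are witnesses `f0 f1` disagreeing on every element of `S` such that every
dichotomy of `S` is realized by some member of `F`. -/
def Shatters {P : Type*} {D : Type*} (F : Set (P → D)) (S : Finset P) : Prop :=
  ∃ f0 f1 : P → D,
    (∀ x ∈ S, f0 x ≠ f1 x) ∧
    ∀ B ⊆ S, ∃ f ∈ F, (∀ x ∈ B, f x = f0 x) ∧ ∀ x ∈ S, x ∉ B → f x = f1 x

/-- The parameterized maximizer with class-sensitive feature mapping `ψ` and
parameter vector `w`: it selects the atomic decisions maximizing `ψ(P,d)·w`. -/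
def paramMaximizer {E D : Type*} {η : ℕ}
    (ψ : List E → D → Fin η → ℝ) (w : Fin η → ℝ) (P : List E) : Set D :=
  {d | ∀ d' : D, ∑ i, ψ P d' i * w i ≤ ∑ i, ψ P d i * w i}

/-- Vectors realizing every sign pattern (positive versus nonpositive) under the dot product
with a common test vector are linearly independent. -/
theorem linearIndependent_of_forall_sign_pattern {ι n : Type*} [Fintype ι] [Fintype n]
    (v : ι → n → ℝ) (hv : ∀ T : Set ι, ∃ w : n → ℝ, ∀ x, 0 < v x ⬝ᵥ w ↔ x ∈ T) :
    LinearIndependent ℝ v := by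
  have nonpos_coeff : ∀ g : ι → ℝ, ∑ x, g x • v x = 0 → ∀ x, g x ≤ 0 := by
    intro g hg x
    by_contra! hx
    obtain ⟨w, hw⟩ := hv {y | 0 < g y}
    have hsum : ∑ y, g y * (v y ⬝ᵥ w) = 0 := by
      simpa [sum_dotProduct] using congrArg (· ⬝ᵥ w) hg
    have hnonneg : ∀ y, 0 ≤ g y * (v y ⬝ᵥ w) := by
      intro y
      by_cases hy : 0 < g y
      · exact (mul_pos hy ((hw y).2 hy)).le
      · exact mul_nonneg_of_nonpos_of_nonpos (not_lt.1 hy) (not_lt.1 (mt (hw y).1 hy))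
    exact (Finset.sum_pos' (fun y _ => hnonneg y)
      ⟨x, Finset.mem_univ x, mul_pos hx ((hw x).2 hx)⟩).ne' hsum
  refine Fintype.linearIndependent_iff.2 fun g hg x => le_antisymm (nonpos_coeff g hg x) ?_
  simpa using nonpos_coeff (-g) (by simp [hg]) x

theorem paramMaximizer_nonempty {E D : Type*} [Finite D] [Nonempty D] {η : ℕ}
    (ψ : List E → D → Fin η → ℝ) (w : Fin η → ℝ) (P : List E) :
    (paramMaximizer ψ w P).Nonempty :=
  Finite.exists_max fun d => ∑ i, ψ P d i * w i

/-- If `A` has a decision outside the nonempty set `B`, some vector has positive dot product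
with all parameters selecting `B` and nonpositive dot product with all those selecting `A`. -/
theorem exists_separating_of_not_subset {E D : Type*} {η : ℕ}
    (ψ : List E → D → Fin η → ℝ) (P : List E) {A B : Set D} (hB : B.Nonempty)
    (hAB : ¬ A ⊆ B) :
    ∃ v : Fin η → ℝ, (∀ w, paramMaximizer ψ w P = B → 0 < v ⬝ᵥ w) ∧
      ∀ w, paramMaximizer ψ w P = A → v ⬝ᵥ w ≤ 0 := by
  obtain ⟨d, hdA, hdB⟩ := Set.not_subset.1 hAB
  obtain ⟨b, hb⟩ := hB
  refine ⟨ψ P b - ψ P d, ?_, ?_⟩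
  · rintro w rfl
    rw [sub_dotProduct, sub_pos]
    by_contra! h
    exact hdB fun d' => (hb d').trans h
  · rintro w rfl
    rw [sub_dotProduct, sub_nonpos]
    exact hdA b

/-- Distinct nonempty sets of decisions are separated by a vector, in one of two orientations. -/
theorem exists_separating {E D : Type*} {η : ℕ}
    (ψ : List E → D → Fin η → ℝ) (P : List E) {A B : Set D} (hA : A.Nonempty)
    (hB : B.Nonempty) (hAB : A ≠ B) :
    ∃ (v : Fin η → ℝ) (o : Prop), (∀ w, paramMaximizer ψ w P = A → (0 < v ⬝ᵥ w ↔ o)) ∧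
      ∀ w, paramMaximizer ψ w P = B → (0 < v ⬝ᵥ w ↔ ¬ o) := by
  by_cases h : A ⊆ B
  · obtain ⟨v, hv, hv'⟩ := exists_separating_of_not_subset ψ P hA
      fun h' => hAB (h.antisymm h')
    exact ⟨v, True, fun w hw => by simp [hv w hw], fun w hw => by simp [hv' w hw]⟩
  · obtain ⟨v, hv, hv'⟩ := exists_separating_of_not_subset ψ P hB h
    exact ⟨v, False, fun w hw => by simp [hv' w hw], fun w hw => by simp [hv w hw]⟩

/-- the Natarajan dimension of any family of parameterized
maximizers with `η` parameters is at most `η`. -/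
theorem ndim_param_maximizer {E : Type*} (D : Type*) [Fintype D] [Nonempty D]
    (η : ℕ) (ψ : List E → D → Fin η → ℝ) :
    ∀ S : Finset (List E),
      Shatters {f : List E → Set D | ∃ w : Fin η → ℝ, f = paramMaximizer ψ w} S →
      S.card ≤ η := by
  classical
  rintro S ⟨f0, f1, hne, hS⟩
  have h0 : ∀ x ∈ S, (f0 x).Nonempty := by
    obtain ⟨_, ⟨w, rfl⟩, hw, -⟩ := hS S subset_rfl
    exact fun x hx => hw x hx ▸ paramMaximizer_nonempty ψ w x
  have h1 : ∀ x ∈ S, (f1 x).Nonempty := by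
    obtain ⟨_, ⟨w, rfl⟩, -, hw⟩ := hS ∅ (Finset.empty_subset S)
    exact fun x hx => hw x hx (Finset.notMem_empty x) ▸ paramMaximizer_nonempty ψ w x
  choose v o hv0 hv1 using fun x : S =>
    exists_separating ψ x.1 (h0 x x.2) (h1 x x.2) (hne x x.2)
  have hli : LinearIndependent ℝ v := by
    refine linearIndependent_of_forall_sign_pattern v fun T => ?_
    obtain ⟨_, ⟨w, rfl⟩, hw0, hw1⟩ :=
      hS (S.filter fun x => ∃ hx : x ∈ S, (⟨x, hx⟩ ∈ T ↔ o ⟨x, hx⟩)) (Finset.filter_subset _ _)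
    refine ⟨w, fun ⟨x, hx⟩ => ?_⟩
    by_cases h : ⟨x, hx⟩ ∈ T ↔ o ⟨x, hx⟩
    · rw [hv0 ⟨x, hx⟩ w (hw0 x (Finset.mem_filter.2 ⟨hx, hx, h⟩)), h]
    · rw [hv1 ⟨x, hx⟩ w (hw1 x hx fun hm => h (Finset.mem_filter.1 hm).2.2)]
      tauto
  simpa using hli.fintype_card_le_finrank
end

section
/- For all integers k ≥ 2 and m ≥ k+1, the class of all Thiele methods (with nondecreasing, nonconstant score vectors) shatters some set of k−1 approval profiles; consequently the Natarajan dimension of the class of Thiele methods is at least k−1. -/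
/-- The Thiele score `Σ_{A ∈ P} s_{|A ∩ W|}` of committee `W` at profile `P`. -/
def thieleScore {m : ℕ} (s : ℕ → ℝ) (P : List (Finset (Fin m)))
    (W : Finset (Fin m)) : ℝ :=
  (P.map fun A => s (A ∩ W).card).sum

/-- The Thiele method with score vector `s`: all `k`-committees of maximum score. -/
def thiele {m : ℕ} (k : ℕ) (s : ℕ → ℝ) (P : List (Finset (Fin m))) :
    Set (Finset (Fin m)) :=
  {W | W.card = k ∧
    ∀ W' : Finset (Fin m), W'.card = k → thieleScore s P W' ≤ thieleScore s P W}

/-- The class of all Thiele methods: score vectors `(s_0, …, s_k)` that are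
nondecreasing and not constant. -/
def ThieleFamily (m k : ℕ) :
    Set (List (Finset (Fin m)) → Set (Finset (Fin m))) :=
  {f | ∃ s : ℕ → ℝ, (∀ i < k, s i ≤ s (i + 1)) ∧ (∃ i < k, s i ≠ s (i + 1)) ∧
    f = thiele k s}

open Finset

/-- The score vector whose increments are given by `d`. -/
def scoreOfIncrements (d : ℕ → ℝ) (n : ℕ) : ℝ := ∑ i ∈ range n, d i

/-- One ballot `A`, one singleton ballot for each element of `T \ A`, and `N` ballots `T`. -/
noncomputable def comparisonProfile {m : ℕ} (A T : Finset (Fin m)) (N : ℕ) :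
    List (Finset (Fin m)) :=
  A :: ((T \ A).toList.map (fun x => {x}) ++ List.replicate N T)

theorem thieleScore_comparisonProfile {m : ℕ} (d : ℕ → ℝ) (A T W : Finset (Fin m)) (N : ℕ) :
    thieleScore (scoreOfIncrements d) (comparisonProfile A T N) W =
      scoreOfIncrements d (A ∩ W).card + d 0 * ((T \ A) ∩ W).card +
        N * scoreOfIncrements d (T ∩ W).card := by
  have hsingle : ∀ x : Fin m,
      scoreOfIncrements d ({x} ∩ W).card = if x ∈ W then d 0 else 0 := by
    intro x
    by_cases hx : x ∈ W <;> simp [hx, scoreOfIncrements]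
  have hsum : (((T \ A).toList.map fun x => scoreOfIncrements d ({x} ∩ W).card)).sum =
      d 0 * ((T \ A) ∩ W).card := by
    rw [Finset.sum_map_toList, sum_congr rfl fun x _ => hsingle x, ← sum_filter,
      filter_mem_eq_inter, sum_const, nsmul_eq_mul, mul_comm]
  simp only [thieleScore, comparisonProfile, List.map_cons, List.map_append, List.map_map,
    List.sum_cons, List.sum_append, List.map_replicate, List.sum_replicate, nsmul_eq_mul,
    Function.comp_def, hsum]
  ring

theorem thiele_eq_of_score_lt {m k : ℕ} {s : ℕ → ℝ} {P : List (Finset (Fin m))}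
    {good : Finset (Fin m) → Prop} (hex : ∃ W, W.card = k ∧ good W)
    (heq : ∀ W W', W.card = k → W'.card = k → good W → good W' →
      thieleScore s P W' ≤ thieleScore s P W)
    (hlt : ∀ W W', W.card = k → W'.card = k → good W → ¬ good W' →
      thieleScore s P W' < thieleScore s P W) :
    thiele k s P = {W | W.card = k ∧ good W} := by
  ext W
  constructor
  · rintro ⟨hW, hmax⟩
    refine ⟨hW, ?_⟩
    by_contra hbad
    obtain ⟨V, hV, hgood⟩ := hex
    exact (hlt V W hV hW hgood hbad).not_ge (hmax V hV)
  · rintro ⟨hW, hgood⟩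
    refine ⟨hW, fun W' hW' => ?_⟩
    by_cases h : good W'
    · exact heq W W' hW hW' hgood h
    · exact (hlt W W' hW hW' hgood h).le

theorem scoreOfIncrements_mono {d : ℕ → ℝ} (hd : ∀ n, 1 ≤ d n) : Monotone (scoreOfIncrements d) :=
  monotone_nat_of_le_succ fun n => by
    simp only [scoreOfIncrements, sum_range_succ]
    linarith [hd n]

theorem scoreOfIncrements_le {d : ℕ → ℝ} (hd : ∀ n, d n ≤ 3) (n : ℕ) :
    scoreOfIncrements d n ≤ 3 * n := by
  calc scoreOfIncrements d n ≤ ∑ _i ∈ range n, (3 : ℝ) := sum_le_sum fun i _ => hd i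
    _ = 3 * n := by simp [mul_comm]

theorem card_inter_of_subset_of_card_succ {α : Type*} [DecidableEq α] {k i : ℕ}
    {A T W : Finset α} (hT : T.card = k + 1) (hA : A.card = i + 1) (hAT : A ⊆ T)
    (hW : W.card = k) (hWT : W ⊆ T) : (A ∩ W).card = if A ⊆ W then i + 1 else i := by
  split_ifs with h
  · rw [inter_eq_left.mpr h, hA]
  · have h1 : (A \ W).card ≤ (T \ W).card := card_le_card (sdiff_subset_sdiff hAT subset_rfl)
    have h2 := card_sdiff_of_subset hWT
    have h3 := card_inter_add_card_sdiff A W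
    have h4 : 0 < (A \ W).card := card_pos.mpr (sdiff_nonempty.mpr h)
    omega

section Comparison

variable {m k i : ℕ} {d : ℕ → ℝ} {A T : Finset (Fin m)}

theorem thieleScore_comparisonProfile_of_subset (hd0 : d 0 = 2) (hT : T.card = k + 1)
    (hA : A.card = i + 1) (hAT : A ⊆ T) {N : ℕ} {W : Finset (Fin m)} (hW : W.card = k)
    (hWT : W ⊆ T) :
    thieleScore (scoreOfIncrements d) (comparisonProfile A T N) W =
      scoreOfIncrements d i - 2 * i + (if A ⊆ W then d i - 2 else 0) + 2 * k +
        N * scoreOfIncrements d k := by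
  have h1 := card_inter_of_subset_of_card_succ hT hA hAT hW hWT
  have h2 : (A ∩ W).card + ((T \ A) ∩ W).card = k := by
    rw [← card_union_of_disjoint, ← union_inter_distrib_right, union_sdiff_of_subset hAT,
      inter_eq_right.mpr hWT, hW]
    exact disjoint_sdiff.mono inter_subset_left inter_subset_left
  have h3 : (((T \ A) ∩ W).card : ℝ) = k - (A ∩ W).card := by
    rw [← h2]; push_cast; ring
  rw [thieleScore_comparisonProfile, inter_eq_right.mpr hWT, hW, hd0, h3, h1]
  split_ifs
  · simp only [scoreOfIncrements, sum_range_succ]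
    push_cast
    ring
  · ring

theorem thieleScore_comparisonProfile_lt (hd0 : d 0 = 2) (hd1 : ∀ n, 1 ≤ d n)
    (hd3 : ∀ n, d n ≤ 3) {W W' : Finset (Fin m)} (hW : W.card = k) (hWT : W ⊆ T)
    (hW' : W'.card = k) (hWT' : ¬ W' ⊆ T) :
    thieleScore (scoreOfIncrements d) (comparisonProfile A T (5 * k + 1)) W' <
      thieleScore (scoreOfIncrements d) (comparisonProfile A T (5 * k + 1)) W := by
  have hmono := scoreOfIncrements_mono hd1
  have hnonneg : ∀ n, 0 ≤ scoreOfIncrements d n := fun n => by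
    simpa [scoreOfIncrements] using hmono (Nat.zero_le n)
  have hlt : (T ∩ W').card + 1 ≤ k := by
    rw [← hW']
    refine card_lt_card ⟨inter_subset_right, fun h => hWT' ?_⟩
    exact h.trans inter_subset_left
  have h1 : scoreOfIncrements d (T ∩ W').card + 1 ≤ scoreOfIncrements d k := by
    refine le_trans ?_ (hmono hlt)
    have := hd1 (T ∩ W').card
    simp only [scoreOfIncrements, sum_range_succ] at *
    linarith
  have h2 : scoreOfIncrements d (A ∩ W').card ≤ 3 * k := by
    refine (hmono ?_).trans (scoreOfIncrements_le hd3 k)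
    exact hW' ▸ card_le_card inter_subset_right
  have h3 : (((T \ A) ∩ W').card : ℝ) ≤ k := by
    exact_mod_cast hW' ▸ card_le_card inter_subset_right
  rw [thieleScore_comparisonProfile, thieleScore_comparisonProfile, inter_eq_right.mpr hWT, hW,
    hd0]
  have h4 := mul_le_mul_of_nonneg_left h1 (Nat.cast_nonneg (α := ℝ) (5 * k + 1))
  have h5 := hnonneg (A ∩ W).card
  have h6 : (0 : ℝ) ≤ ((T \ A) ∩ W).card := Nat.cast_nonneg _
  push_cast at h4 ⊢
  linarith

theorem thiele_comparisonProfile_of_two_lt (hd0 : d 0 = 2) (hd1 : ∀ n, 1 ≤ d n)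
    (hd3 : ∀ n, d n ≤ 3) (hT : T.card = k + 1) (hA : A.card = i + 1) (hAT : A ⊆ T)
    (hik : i < k) (hi : 2 < d i) :
    thiele k (scoreOfIncrements d) (comparisonProfile A T (5 * k + 1)) =
      {W | W.card = k ∧ W ⊆ T ∧ A ⊆ W} := by
  apply thiele_eq_of_score_lt
  · obtain ⟨W, hAW, hWT, hW⟩ := exists_subsuperset_card_eq hAT (n := k) (by omega) (by omega)
    exact ⟨W, hW, hWT, hAW⟩
  · rintro W W' hW hW' ⟨hWT, hAW⟩ ⟨hWT', hAW'⟩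
    rw [thieleScore_comparisonProfile_of_subset hd0 hT hA hAT hW hWT,
      thieleScore_comparisonProfile_of_subset hd0 hT hA hAT hW' hWT', if_pos hAW, if_pos hAW']
  · rintro W W' hW hW' ⟨hWT, hAW⟩ hbad
    by_cases hWT' : W' ⊆ T
    · rw [thieleScore_comparisonProfile_of_subset hd0 hT hA hAT hW hWT,
        thieleScore_comparisonProfile_of_subset hd0 hT hA hAT hW' hWT', if_pos hAW,
        if_neg fun h => hbad ⟨hWT', h⟩]
      linarith
    · exact thieleScore_comparisonProfile_lt hd0 hd1 hd3 hW hWT hW' hWT'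

theorem thiele_comparisonProfile_of_lt_two (hd0 : d 0 = 2) (hd1 : ∀ n, 1 ≤ d n)
    (hd3 : ∀ n, d n ≤ 3) (hT : T.card = k + 1) (hA : A.card = i + 1) (hAT : A ⊆ T)
    (hi : d i < 2) :
    thiele k (scoreOfIncrements d) (comparisonProfile A T (5 * k + 1)) =
      {W | W.card = k ∧ W ⊆ T ∧ ¬ A ⊆ W} := by
  apply thiele_eq_of_score_lt
  · obtain ⟨a, ha⟩ : A.Nonempty := card_pos.mp (by omega)
    refine ⟨T.erase a, by rw [card_erase_of_mem (hAT ha), hT]; rfl, erase_subset _ _, ?_⟩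
    exact fun h => notMem_erase a T (h ha)
  · rintro W W' hW hW' ⟨hWT, hAW⟩ ⟨hWT', hAW'⟩
    rw [thieleScore_comparisonProfile_of_subset hd0 hT hA hAT hW hWT,
      thieleScore_comparisonProfile_of_subset hd0 hT hA hAT hW' hWT', if_neg hAW, if_neg hAW']
  · rintro W W' hW hW' ⟨hWT, hAW⟩ hbad
    by_cases hWT' : W' ⊆ T
    · rw [thieleScore_comparisonProfile_of_subset hd0 hT hA hAT hW hWT,
        thieleScore_comparisonProfile_of_subset hd0 hT hA hAT hW' hWT', if_neg hAW,
        if_pos (not_not.mp fun h => hbad ⟨hWT', h⟩)]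
      linarith
    · exact thieleScore_comparisonProfile_lt hd0 hd1 hd3 hW hWT hW' hWT'

end Comparison

theorem thiele_scoreOfIncrements_mem_thieleFamily {m k : ℕ} (hk : 0 < k) {d : ℕ → ℝ}
    (hd : ∀ n, 1 ≤ d n) : thiele k (scoreOfIncrements d) ∈ ThieleFamily m k := by
  refine ⟨_, fun i _ => scoreOfIncrements_mono hd i.le_succ, ⟨0, hk, ?_⟩, rfl⟩
  have := hd 0
  simp only [scoreOfIncrements, sum_range_succ, range_zero, sum_empty]
  linarith

/-- The increments equal to `2` at `0`, to `3` at the other elements of `p`, to `1` elsewhere. -/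
noncomputable def dichotomyIncrements (p : ℕ → Prop) (n : ℕ) : ℝ :=
  open Classical in if n = 0 then 2 else if p n then 3 else 1

theorem one_le_dichotomyIncrements (p : ℕ → Prop) (n : ℕ) : 1 ≤ dichotomyIncrements p n := by
  unfold dichotomyIncrements
  split_ifs <;> norm_num

theorem dichotomyIncrements_le_three (p : ℕ → Prop) (n : ℕ) : dichotomyIncrements p n ≤ 3 := by
  unfold dichotomyIncrements
  split_ifs <;> norm_num

/-- for all `k ≥ 2` and `m ≥ k+1`, the class of Thiele methods
shatters a set of `k - 1` approval profiles; hence its Natarajan dimension is at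
least `k - 1`. -/
theorem thiele_ndim_lower (m k : ℕ) (hk : 2 ≤ k) (hm : k + 1 ≤ m) :
    ∃ S : Finset (List (Finset (Fin m))),
      S.card = k - 1 ∧ Shatters (ThieleFamily m k) S := by
  classical
  obtain ⟨T, hT⟩ : ∃ T : ℕ → Finset (Fin m), ∀ n ≤ m, (T n).card = n ∧ ∀ l ≤ n, T l ⊆ T n := by
    refine ⟨fun n => univ.filter fun x => x.val < n, fun n hn => ⟨?_, fun l hl x => ?_⟩⟩
    · simp [Fin.card_filter_val_lt, hn]
    · simp only [mem_filter_univ]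
      omega
  have hTk := (hT (k + 1) hm).1
  have hA : ∀ i < k, (T (i + 1)).card = i + 1 := fun i hi => (hT _ (by omega)).1
  have hAT : ∀ i < k, T (i + 1) ⊆ T (k + 1) := fun i hi => (hT _ hm).2 _ (by omega)
  let Q : ℕ → List (Finset (Fin m)) := fun i =>
    comparisonProfile (T (i + 1)) (T (k + 1)) (5 * k + 1)
  have htrue : ∀ (p : ℕ → Prop) (i : ℕ), i ∈ Ico 1 k → p i →
      thiele k (scoreOfIncrements (dichotomyIncrements p)) (Q i) =
        {W | W.card = k ∧ W ⊆ T (k + 1) ∧ T (i + 1) ⊆ W} := by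
    intro p i hi hp
    obtain ⟨h1, h2⟩ := mem_Ico.mp hi
    refine thiele_comparisonProfile_of_two_lt (if_pos rfl) (one_le_dichotomyIncrements p)
      (dichotomyIncrements_le_three p) hTk (hA i h2) (hAT i h2) h2 ?_
    rw [dichotomyIncrements, if_neg (by omega), if_pos hp]
    norm_num
  have hfalse : ∀ (p : ℕ → Prop) (i : ℕ), i ∈ Ico 1 k → ¬ p i →
      thiele k (scoreOfIncrements (dichotomyIncrements p)) (Q i) =
        {W | W.card = k ∧ W ⊆ T (k + 1) ∧ ¬ T (i + 1) ⊆ W} := by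
    intro p i hi hp
    obtain ⟨h1, h2⟩ := mem_Ico.mp hi
    refine thiele_comparisonProfile_of_lt_two (if_pos rfl) (one_le_dichotomyIncrements p)
      (dichotomyIncrements_le_three p) hTk (hA i h2) (hAT i h2) ?_
    rw [dichotomyIncrements, if_neg (by omega), if_neg hp]
    norm_num
  refine ⟨(Ico 1 k).image Q, ?_,
    thiele k (scoreOfIncrements (dichotomyIncrements fun _ => True)),
    thiele k (scoreOfIncrements (dichotomyIncrements fun _ => False)), ?_, fun B hB => ?_⟩
  · rw [card_image_of_injOn, Nat.card_Ico]
    intro i hi j hj hij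
    rw [coe_Ico, Set.mem_Ico] at hi hj
    have h := congrArg Finset.card (List.cons.inj hij).1
    rw [hA i hi.2, hA j hj.2] at h
    omega
  · simp only [forall_mem_image]
    intro i hi h
    rw [htrue _ i hi trivial, hfalse _ i hi not_false] at h
    have hik := (mem_Ico.mp hi).2
    obtain ⟨W, hAW, hWT, hW⟩ := exists_subsuperset_card_eq (hAT i hik) (n := k)
      (by rw [hA i hik]; omega) (by omega)
    exact (h.subset (show W ∈ {W | _} from ⟨hW, hWT, hAW⟩)).2.2 hAW
  · refine ⟨thiele k (scoreOfIncrements (dichotomyIncrements fun i => Q i ∈ B)),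
      thiele_scoreOfIncrements_mem_thieleFamily (by omega) (one_le_dichotomyIncrements _),
      fun x hx => ?_, ?_⟩
    · obtain ⟨i, hi, rfl⟩ := mem_image.mp (hB hx)
      rw [htrue _ i hi hx, htrue _ i hi trivial]
    · simp only [forall_mem_image]
      intro i hi hx
      rw [hfalse _ i hi hx, hfalse _ i hi not_false]
end

section
/- The Natarajan dimension of any family of parameterized hyperplanes is at most 2η·log₂(8eK) + 2·log₂|𝒢|: let K ≥ 1, let ψ assign to each profile P and each index j ∈ {1,…,K} a vector ψ(P,j) ∈ ℝ^η, let 𝒢 be a finite nonempty set of functions from {+,−,0}^K to a decision space 𝒟, and for w ∈ ℝ^η and g ∈ 𝒢 define f_{w,g}(P) = g(sign(ψ(P,1)·w),…,sign(ψ(P,K)·w)). Then Ndim({ f_{w,g} : w ∈ ℝ^η, g ∈ 𝒢 }) ≤ 2η·log₂(8eK) + 2·log₂|𝒢|. -/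
/-- The parameterized hyperplane `f_{w,g}`: it applies `g` to the signs of the dot
products of the `K` hyperplane-sensitive feature vectors of `P` with `w`. -/
noncomputable def paramHyperplane {E D : Type*} {η K : ℕ}
    (ψ : List E → Fin K → Fin η → ℝ) (w : Fin η → ℝ)
    (g : (Fin K → SignType) → D) (P : List E) : D :=
  g fun j => SignType.sign (∑ i, ψ P j i * w i)

/-- The sign patterns realized by the functionals `φ` on the subspace `V`. -/
def signPatterns {M : Type*} [AddCommGroup M] [Module ℝ M] {m : ℕ}
    (φ : Fin m → Module.Dual ℝ M) (V : Submodule ℝ M) : Set (Fin m → SignType) :=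
  (fun w j => SignType.sign (φ j w)) '' (V : Set M)

theorem sign_add_of_sign_eq {x y a b : ℝ} (ha : 0 < a) (hb : 0 < b)
    (h : SignType.sign x = SignType.sign y) :
    SignType.sign (a * x + b * y) = SignType.sign x := by
  rcases lt_trichotomy x 0 with hx | rfl | hx
  · have hy : y < 0 := by rwa [sign_neg hx, eq_comm, sign_eq_neg_one_iff] at h
    rw [sign_neg hx, sign_neg (by nlinarith [mul_pos ha (neg_pos.2 hx), mul_pos hb (neg_pos.2 hy)])]
  · have hy : y = 0 := by rwa [sign_zero, eq_comm, sign_eq_zero_iff] at h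
    simp [hy]
  · have hy : 0 < y := by rwa [sign_pos hx, eq_comm, sign_eq_one_iff] at h
    rw [sign_pos hx, sign_pos (by positivity)]

section SignPatterns

variable {M : Type*} [AddCommGroup M] [Module ℝ M] {m : ℕ}

/-- Deleting the first functional, the patterns of `V` at which it is positive and those at which
it is negative overlap only in patterns realized on its kernel. -/
theorem ncard_signPatterns_succ_le (φ : Fin (m + 1) → Module.Dual ℝ M) (V : Submodule ℝ M) :
    (signPatterns φ V).ncard ≤ (signPatterns (Fin.tail φ) V).ncard +
      2 * (signPatterns (Fin.tail φ) (V ⊓ LinearMap.ker (φ 0))).ncard := by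
  set C := signPatterns (Fin.tail φ) (V ⊓ LinearMap.ker (φ 0))
  let ext (s : SignType) (σ : Fin m → SignType) : Fin (m + 1) → SignType := Fin.cons s σ
  let T (s : SignType) : Set (Fin m → SignType) := {σ | ext s σ ∈ signPatterns φ V}
  have hcover : signPatterns φ V ⊆ (ext 0 '' C ∪ ext 1 '' T 1) ∪ ext (-1) '' T (-1) := by
    rintro _ ⟨w, hw, rfl⟩
    have hcons : ext (SignType.sign (φ 0 w)) (fun j => SignType.sign (φ j.succ w)) =
        fun j => SignType.sign (φ j w) := by
      funext j
      refine Fin.cases ?_ (fun i => ?_) j <;> simp [ext]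
    rcases lt_trichotomy (φ 0 w) 0 with h | h | h
    · rw [sign_neg h] at hcons
      exact .inr ⟨_, ⟨w, hw, hcons.symm⟩, hcons⟩
    · rw [h, sign_zero] at hcons
      exact .inl (.inl ⟨_, ⟨w, ⟨hw, h⟩, rfl⟩, hcons⟩)
    · rw [sign_pos h] at hcons
      exact .inl (.inr ⟨_, ⟨w, hw, hcons.symm⟩, hcons⟩)
  have hT (s : SignType) : T s ⊆ signPatterns (Fin.tail φ) V := by
    rintro σ ⟨w, hw, h⟩
    exact ⟨w, hw, funext fun j => by simpa [ext, Fin.tail] using congrFun h j.succ⟩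
  have hinter : T 1 ∩ T (-1) ⊆ C := by
    rintro σ ⟨⟨u, hu, h⟩, ⟨v, hv, k⟩⟩
    have hu0 : 0 < φ 0 u := by simpa [ext, sign_eq_one_iff] using congrFun h 0
    have hv0 : φ 0 v < 0 := by simpa [ext, sign_eq_neg_one_iff] using congrFun k 0
    refine ⟨(-φ 0 v) • u + φ 0 u • v,
      ⟨V.add_mem (V.smul_mem _ hu) (V.smul_mem _ hv), ?_⟩, funext fun j => ?_⟩
    · simp only [SetLike.mem_coe, LinearMap.mem_ker, map_add, map_smul, smul_eq_mul]
      ring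
    · have hj : SignType.sign (φ j.succ u) = σ j := by simpa [ext] using congrFun h j.succ
      have kj : SignType.sign (φ j.succ v) = σ j := by simpa [ext] using congrFun k j.succ
      simp only [Fin.tail, map_add, map_smul, smul_eq_mul]
      rw [sign_add_of_sign_eq (neg_pos.2 hv0) hu0 (hj.trans kj.symm), hj]
  have h1 := Set.ncard_le_ncard hcover (Set.toFinite _)
  have h2 := Set.ncard_union_le (ext 0 '' C ∪ ext 1 '' T 1) (ext (-1) '' T (-1))
  have h3 := Set.ncard_union_le (ext 0 '' C) (ext 1 '' T 1)
  have h4 := Set.ncard_image_le (f := ext 0) (Set.toFinite C)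
  have h5 := Set.ncard_image_le (f := ext 1) (Set.toFinite (T 1))
  have h6 := Set.ncard_image_le (f := ext (-1)) (Set.toFinite (T (-1)))
  have h7 := Set.ncard_union_add_ncard_inter (T 1) (T (-1))
  have h8 := Set.ncard_le_ncard (Set.union_subset (hT 1) (hT (-1))) (Set.toFinite _)
  have h9 := Set.ncard_le_ncard hinter (Set.toFinite _)
  omega

theorem ncard_signPatterns_succ_le_of_le_ker (φ : Fin (m + 1) → Module.Dual ℝ M)
    (V : Submodule ℝ M) (h : V ≤ LinearMap.ker (φ 0)) :
    (signPatterns φ V).ncard ≤ (signPatterns (Fin.tail φ) V).ncard := by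
  let ext (σ : Fin m → SignType) : Fin (m + 1) → SignType := Fin.cons 0 σ
  refine (Set.ncard_le_ncard (t := ext '' signPatterns (Fin.tail φ) V) ?_
    (Set.toFinite _)).trans (Set.ncard_image_le (Set.toFinite _))
  rintro _ ⟨w, hw, rfl⟩
  refine ⟨_, ⟨w, hw, rfl⟩, funext fun j => ?_⟩
  have hw0 : φ 0 w = 0 := h hw
  refine Fin.cases ?_ (fun i => ?_) j
  · simp [ext, hw0]
  · simp [ext, Fin.tail]

theorem ncard_signPatterns_le [FiniteDimensional ℝ M] {c : ℝ} (hc : 1 ≤ c)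
    (φ : Fin m → Module.Dual ℝ M) (V : Submodule ℝ M) :
    ((signPatterns φ V).ncard : ℝ) ≤ c ^ Module.finrank ℝ V * (1 + 2 / c) ^ m := by
  have hc0 : 0 < c := by linarith
  induction m generalizing V with
  | zero =>
    have h : (signPatterns φ V).ncard ≤ 1 := Set.ncard_le_one_of_subsingleton _
    calc ((signPatterns φ V).ncard : ℝ) ≤ 1 := by exact_mod_cast h
      _ ≤ _ := by simpa using one_le_pow₀ hc
  | succ m ih =>
    have hV := ih (Fin.tail φ) V
    by_cases h : V ≤ LinearMap.ker (φ 0)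
    · have h1 : ((signPatterns φ V).ncard : ℝ) ≤ (signPatterns (Fin.tail φ) V).ncard := by
        exact_mod_cast ncard_signPatterns_succ_le_of_le_ker φ V h
      refine (h1.trans hV).trans ?_
      gcongr
      · have : 0 ≤ 2 / c := by positivity
        linarith
      · omega
    · have h1 : ((signPatterns φ V).ncard : ℝ) ≤ (signPatterns (Fin.tail φ) V).ncard +
          2 * (signPatterns (Fin.tail φ) (V ⊓ LinearMap.ker (φ 0))).ncard := by
        exact_mod_cast ncard_signPatterns_succ_le φ V
      have hW := ih (Fin.tail φ) (V ⊓ LinearMap.ker (φ 0))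
      have hlt : Module.finrank ℝ ↥(V ⊓ LinearMap.ker (φ 0)) < Module.finrank ℝ V :=
        Submodule.finrank_lt_finrank_of_lt (inf_lt_left.2 h)
      have hpow : c ^ Module.finrank ℝ ↥(V ⊓ LinearMap.ker (φ 0)) ≤
          c ^ Module.finrank ℝ V / c := by
        rw [le_div_iff₀ hc0, ← pow_succ]
        exact pow_le_pow_right₀ hc hlt
      calc _ ≤ _ := h1
        _ ≤ c ^ Module.finrank ℝ V * (1 + 2 / c) ^ m +
            2 * (c ^ Module.finrank ℝ V / c * (1 + 2 / c) ^ m) := by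
          gcongr
          exact hW.trans (by gcongr)
        _ = _ := by
          rw [pow_succ]
          ring

end SignPatterns

/-- A shattering family whose values on `S` depend only on a label of the parameter has at least
`2 ^ S.card` labels. -/
theorem two_pow_card_le_ncard_of_shatters {P D A L : Type*} {f : A → P → D} {S : Finset P}
    (hS : Shatters (Set.range f) S) (label : A → L) {T : Set L} (hT : T.Finite)
    (hlabel : ∀ a, label a ∈ T)
    (hf : ∀ a b, label a = label b → ∀ x ∈ S, f a x = f b x) :
    2 ^ S.card ≤ T.ncard := by
  obtain ⟨f0, f1, hne, hS⟩ := hS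
  have key : ∀ B : S.powerset, ∃ a, (∀ x ∈ B.1, f a x = f0 x) ∧
      ∀ x ∈ S, x ∉ B.1 → f a x = f1 x := fun B => by
    obtain ⟨_, ⟨a, rfl⟩, h⟩ := hS B.1 (Finset.mem_powerset.1 B.2)
    exact ⟨a, h⟩
  choose a ha0 ha1 using key
  have hsub : ∀ B C : S.powerset, label (a B) = label (a C) → B.1 ⊆ C.1 := by
    intro B C h x hx
    by_contra hxC
    have hxS := Finset.mem_powerset.1 B.2 hx
    exact hne x hxS ((ha0 B x hx).symm.trans ((hf _ _ h x hxS).trans (ha1 C x hxS hxC)))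
  have hinj : Function.Injective fun B => label (a B) := fun B C h =>
    Subtype.ext ((hsub B C h).antisymm (hsub C B h.symm))
  calc 2 ^ S.card = (Set.range fun B => label (a B)).ncard := by
        rw [← Set.image_univ, Set.ncard_image_of_injective _ hinj, Set.ncard_univ,
          Nat.card_eq_fintype_card, Fintype.card_coe, Finset.card_powerset]
    _ ≤ T.ncard := Set.ncard_le_ncard (Set.range_subset_iff.2 fun B => hlabel _) hT

/-- the Natarajan dimension of any family of parameterized
hyperplanes is at most `2η·log₂(8eK) + 2·log₂|𝒢|`. -/
theorem ndim_param_hyperplanes {E D : Type*} (η K : ℕ) (hK : 1 ≤ K)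
    (ψ : List E → Fin K → Fin η → ℝ)
    (G : Finset ((Fin K → SignType) → D)) (hG : G.Nonempty) :
    ∀ S : Finset (List E),
      Shatters {f : List E → D | ∃ w : Fin η → ℝ, ∃ g ∈ G,
        f = paramHyperplane ψ w g} S →
      (S.card : ℝ) ≤ 2 * η * Real.logb 2 (8 * Real.exp 1 * K)
        + 2 * Real.logb 2 (G.card : ℝ) := by
  intro S hS
  let e := Fintype.equivFin (S × Fin K)
  let φ : Fin (Fintype.card (S × Fin K)) → Module.Dual ℝ (Fin η → ℝ) := fun j =>
    Fintype.linearCombination ℝ (ψ (e.symm j).1.1 (e.symm j).2)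
  have hφ (j w) : φ j w = ∑ i, ψ (e.symm j).1.1 (e.symm j).2 i * w i := by
    simp [φ, Fintype.linearCombination_apply, mul_comm]
  have hcount : 2 ^ S.card ≤ (signPatterns φ ⊤ ×ˢ (G : Set ((Fin K → SignType) → D))).ncard := by
    refine two_pow_card_le_ncard_of_shatters
      (f := fun a : (Fin η → ℝ) × G => paramHyperplane ψ a.1 a.2.1) ?_
      (fun a => (fun j => SignType.sign (φ j a.1), a.2.1))
      ((Set.toFinite _).prod G.finite_toSet) (fun a => ⟨⟨a.1, trivial, rfl⟩, a.2.2⟩) ?_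
    · convert hS using 1
      ext f
      constructor
      · rintro ⟨⟨w, g⟩, rfl⟩
        exact ⟨w, g.1, g.2, rfl⟩
      · rintro ⟨w, g, hg, rfl⟩
        exact ⟨(w, ⟨g, hg⟩), rfl⟩
    · rintro ⟨w, g⟩ ⟨w', g'⟩ h x hx
      obtain ⟨h1, h2⟩ := Prod.mk.inj h
      replace h2 : g.1 = g'.1 := h2
      simp only [paramHyperplane, h2]
      refine congrArg g'.1 (funext fun j => ?_)
      simpa [hφ] using congrFun h1 (e (⟨x, hx⟩, j))
  have hK0 : (1 : ℝ) ≤ K := by exact_mod_cast hK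
  have hG0 : (0 : ℝ) < G.card := by exact_mod_cast hG.card_pos
  have hN := ncard_signPatterns_le (c := 8 * K) (by linarith) φ ⊤
  rw [finrank_top, Module.finrank_fin_fun] at hN
  have hexp : (1 + 2 / (8 * K : ℝ)) ^ Fintype.card (S × Fin K) ≤ Real.exp (S.card / 4) := by
    rw [Fintype.card_prod, Fintype.card_coe, Fintype.card_fin]
    calc (1 + 2 / (8 * K : ℝ)) ^ (S.card * K)
        ≤ Real.exp (2 / (8 * K : ℝ)) ^ (S.card * K) := by
          gcongr
          linarith [Real.add_one_le_exp (2 / (8 * K : ℝ))]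
      _ = Real.exp (S.card / 4) := by
          rw [← Real.exp_nat_mul]
          congr 1
          push_cast
          field_simp
          ring
  have hmain : (2 : ℝ) ^ S.card ≤ (8 * K) ^ η * Real.exp (S.card / 4) * G.card := by
    rw [Set.ncard_prod, Set.ncard_coe_finset] at hcount
    calc (2 : ℝ) ^ S.card ≤ (signPatterns φ ⊤).ncard * G.card := by exact_mod_cast hcount
      _ ≤ _ := by
        gcongr
        exact hN.trans (by gcongr)
  have hlog := Real.log_le_log (by positivity) hmain
  rw [Real.log_mul (by positivity) hG0.ne', Real.log_mul (by positivity) (by positivity),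
    Real.log_exp, Real.log_pow, Real.log_pow] at hlog
  have h8 : Real.log (8 * K) ≤ Real.log (8 * Real.exp 1 * K) := by
    refine Real.log_le_log (by positivity) ?_
    nlinarith [Real.add_one_le_exp (1 : ℝ)]
  have h2 := Real.log_two_gt_d9
  have hη : (η : ℝ) * Real.log (8 * K) ≤ η * Real.log (8 * Real.exp 1 * K) := by gcongr
  have hn : (S.card : ℝ) * (1 / 2) ≤ S.card * Real.log 2 := by
    gcongr
    linarith
  simp only [Real.logb]
  rw [mul_div_assoc', mul_div_assoc', ← add_div, le_div_iff₀ (by linarith)]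
  linarith
end

section
/- Under p-Impartial Culture, with probability 1 − exp(−Θ(n)) every k-committee is in the CORE, and with probability 1 − exp(−Θ(n)) every k-committee satisfies EJR+. Precisely: for any fixed m, fixed k < m, and fixed p ∈ (0,1), there exist constants c₁ ≥ c₂ > 0 and N such that for all n ≥ N, e^{−c₁·n} ≤ Pr_{P∼(IC_p)^n}( CORE(P) ≠ C_k ) ≤ e^{−c₂·n}, and there exist constants c₁′ ≥ c₂′ > 0 and N′ such that for all n ≥ N′, e^{−c₁′·n} ≤ Pr_{P∼(IC_p)^n}( EJR+(P) ≠ C_k ) ≤ e^{−c₂′·n}. -/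
/-- Probability of an approval set `A` under the `p`-Impartial Culture distribution:
`p^{|A|}·(1-p)^{m-|A|}`. -/
noncomputable def icProb (m : ℕ) (p : ℝ) (A : Finset (Fin m)) : ℝ :=
  p ^ A.card * (1 - p) ^ (m - A.card)

open Classical in
/-- Probability that a profile of `n` i.i.d. `IC_p` approval preferences satisfies
the event `Ev`. -/
noncomputable def prIC (m n : ℕ) (p : ℝ)
    (Ev : (Fin n → Finset (Fin m)) → Prop) : ℝ :=
  ∑ P : Fin n → Finset (Fin m), if Ev P then ∏ j, icProb m p (P j) else 0

/-- `W` is in the core of the profile `P` of `n` agents. -/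
def inCore (m k n : ℕ) (P : Fin n → Finset (Fin m)) (W : Finset (Fin m)) : Prop :=
  ∀ (S : Finset (Fin n)) (W' : Finset (Fin m)),
    S.Nonempty → W'.card * n ≤ S.card * k →
    ∃ j ∈ S, (P j ∩ W').card ≤ (P j ∩ W).card

/-- `W` satisfies EJR+ at the profile `P` of `n` agents. -/
def inEJRplus (m k n : ℕ) (P : Fin n → Finset (Fin m)) (W : Finset (Fin m)) :
    Prop :=
  ¬ ∃ a : Fin m, a ∉ W ∧ ∃ ℓ : ℕ, 1 ≤ ℓ ∧ ℓ ≤ k ∧ ∃ S : Finset (Fin n),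
    ℓ * n ≤ S.card * k ∧ ∀ j ∈ S, a ∈ P j ∧ (P j ∩ W).card < ℓ

open Classical in
/-- The `IC_p`-probability of a property of a single approval preference. -/
noncomputable def icMass (m : ℕ) (p : ℝ) (Q : Finset (Fin m) → Prop) : ℝ :=
  ∑ A : Finset (Fin m), if Q A then icProb m p A else 0

lemma icProb_pos {m : ℕ} {p : ℝ} (hp0 : 0 < p) (hp1 : p < 1) (A : Finset (Fin m)) :
    0 < icProb m p A :=
  mul_pos (pow_pos hp0 _) (pow_pos (sub_pos.2 hp1) _)

lemma sum_icProb (m : ℕ) (p : ℝ) : ∑ A : Finset (Fin m), icProb m p A = 1 := by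
  have h := Fintype.sum_pow_mul_eq_add_pow (Fin m) p (1 - p)
  simpa [icProb] using h

lemma sum_prod_eq_pow (m n : ℕ) (g : Finset (Fin m) → ℝ) :
    ∑ P : Fin n → Finset (Fin m), ∏ j, g (P j) = (∑ A, g A) ^ n := by
  have h := Finset.prod_univ_sum (fun _ : Fin n => (Finset.univ : Finset (Finset (Fin m))))
    (fun _ A => g A)
  simpa using h.symm

lemma icMass_map (m : ℕ) (p : ℝ) (Q : Finset (Fin m) → Prop) (σ : Equiv.Perm (Fin m)) :
    icMass m p (fun A => Q (A.map σ.toEmbedding)) = icMass m p Q := by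
  classical
  unfold icMass
  refine Fintype.sum_equiv σ.finsetCongr _ _ fun A => ?_
  simp [icProb, Equiv.finsetCongr_apply]

/-- Averaging over a family of permutations: if at most `L` of them bring each `A` into `Q`,
then `Q` has probability at most `L / |ι|`. -/
lemma card_mul_icMass_le {m : ℕ} {p : ℝ} (hp0 : 0 < p) (hp1 : p < 1)
    (Q : Finset (Fin m) → Prop) {ι : Type*} [Fintype ι] (σ : ι → Equiv.Perm (Fin m)) (L : ℕ)
    (h : ∀ (A : Finset (Fin m)) (T : Finset ι),
      (∀ i ∈ T, Q (A.map (σ i).toEmbedding)) → T.card ≤ L) :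
    (Fintype.card ι : ℝ) * icMass m p Q ≤ L := by
  classical
  calc (Fintype.card ι : ℝ) * icMass m p Q
      = ∑ i : ι, icMass m p (fun A => Q (A.map (σ i).toEmbedding)) := by
        simp [icMass_map]
    _ = ∑ A : Finset (Fin m),
          ((Finset.univ.filter fun i => Q (A.map (σ i).toEmbedding)).card : ℝ) *
            icProb m p A := by
        unfold icMass
        rw [Finset.sum_comm]
        refine Finset.sum_congr rfl fun A _ => ?_
        rw [← Finset.sum_filter, Finset.sum_const, nsmul_eq_mul]
    _ ≤ ∑ A : Finset (Fin m), (L : ℝ) * icProb m p A := by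
        refine Finset.sum_le_sum fun A _ => ?_
        refine mul_le_mul_of_nonneg_right ?_ (icProb_pos hp0 hp1 A).le
        exact_mod_cast h A _ fun i hi => (Finset.mem_filter.1 hi).2
    _ = L := by rw [← Finset.mul_sum, sum_icProb, mul_one]

lemma icMass_ejrplus_lt {m k ℓ : ℕ} (hk : 1 ≤ k) (hℓ : 1 ≤ ℓ) {p : ℝ} (hp0 : 0 < p)
    (hp1 : p < 1) (W : Finset (Fin m)) (hW : W.card = k) (a : Fin m) (ha : a ∉ W) :
    icMass m p (fun A => a ∈ A ∧ (A ∩ W).card < ℓ) < (ℓ : ℝ) / k := by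
  classical
  have h := card_mul_icMass_le hp0 hp1 (fun A => a ∈ A ∧ (A ∩ W).card < ℓ)
    (ι := {b // b ∈ insert a W}) (fun b => Equiv.swap a b.1) ℓ ?_
  · rw [Fintype.card_coe, Finset.card_insert_of_notMem ha, hW] at h
    have hk' : (0 : ℝ) < k := by exact_mod_cast hk
    have hℓ' : (0 : ℝ) < ℓ := by exact_mod_cast hℓ
    rw [lt_div_iff₀ hk']
    push_cast at h
    nlinarith
  · intro A T hT
    rcases T.eq_empty_or_nonempty with h0 | ⟨b, hb⟩
    · simp [h0]
    · have hmem : ∀ c : Fin m, a ∈ A.map (Equiv.swap a c).toEmbedding ↔ c ∈ A := by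
        intro c
        rw [Finset.mem_map_equiv]
        simp
      have hle : (A ∩ insert a W).card ≤ ℓ := by
        obtain ⟨hab, hlt⟩ := hT b hb
        have himg : (insert a W).map (Equiv.swap a b.1).toEmbedding = insert a W := by
          refine Finset.eq_of_subset_of_card_le (fun x hx => ?_)
            (Finset.card_map _).ge
          rw [Finset.mem_map_equiv, Equiv.symm_swap] at hx
          have hb' := b.2
          rcases eq_or_ne x a with rfl | hxa
          · simp
          · rcases eq_or_ne x b.1 with rfl | hxb
            · exact hb'
            · rwa [Equiv.swap_apply_of_ne_of_ne hxa hxb] at hx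
        rw [← Finset.card_map (Equiv.swap a b.1).toEmbedding, Finset.map_inter, himg,
          Finset.inter_insert_of_mem hab]
        exact (Finset.card_insert_le _ _).trans hlt
      refine le_trans ?_ hle
      refine Finset.card_le_card_of_injOn Subtype.val ?_ Subtype.val_injective.injOn
      intro c hc
      rw [Finset.mem_coe, Finset.mem_inter]
      exact ⟨(hmem _).1 (hT c hc).1, c.2⟩

lemma mul_sdiff_card_le {α : Type*} [DecidableEq α] (W W' : Finset α)
    (hle : W'.card ≤ W.card) (h0 : 1 ≤ W'.card) :
    W.card / W'.card * (W' \ W).card ≤ (W \ W').card := by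
  have h1 := Finset.card_sdiff_add_card_inter W W'
  have h2 := Finset.card_sdiff_add_card_inter W' W
  rw [Finset.inter_comm] at h2
  have h3 := Nat.div_mul_le_self W.card W'.card
  have h4 : 1 ≤ W.card / W'.card := (Nat.one_le_div_iff h0).2 hle
  generalize W.card / W'.card = q at *
  nlinarith

lemma icMass_prefers_lt {m : ℕ} {p : ℝ} (hp0 : 0 < p) (hp1 : p < 1)
    (W W' : Finset (Fin m)) (h0 : 1 ≤ W'.card) (hle : W'.card ≤ W.card) :
    icMass m p (fun A => (A ∩ W).card < (A ∩ W').card) < (W'.card : ℝ) / W.card := by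
  classical
  set q := W.card / W'.card with hq
  set d := (W' \ W).card with hd
  have g0 : Fin d ≃ {x // x ∈ W' \ W} := (W' \ W).equivFin.symm
  obtain ⟨g1⟩ : Nonempty (Fin q × Fin d ↪ {x // x ∈ W \ W'}) := by
    refine Function.Embedding.nonempty_of_card_le ?_
    rw [Fintype.card_prod, Fintype.card_fin, Fintype.card_fin, Fintype.card_coe]
    exact mul_sdiff_card_le W W' hle h0
  let f : Option (Fin q) × Fin d → Fin m := fun y =>
    y.1.elim (g0 y.2).1 fun t => (g1 (t, y.2)).1
  have hf : Function.Injective f := by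
    rintro ⟨_ | s, x⟩ ⟨_ | t, y⟩ hxy
    · have : g0 x = g0 y := Subtype.ext hxy
      rw [g0.injective this]
    · have e : (g0 x).1 = (g1 (t, y)).1 := hxy
      have h1 := (Finset.mem_sdiff.1 (g0 x).2).1
      exact absurd (e ▸ h1) (Finset.mem_sdiff.1 (g1 (t, y)).2).2
    · have e : (g1 (s, x)).1 = (g0 y).1 := hxy
      have h1 := (Finset.mem_sdiff.1 (g0 y).2).1
      exact absurd (e ▸ h1) (Finset.mem_sdiff.1 (g1 (s, x)).2).2
    · have : g1 (s, x) = g1 (t, y) := Subtype.ext hxy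
      have := g1.injective this
      simp only [Prod.mk.injEq] at this
      rw [this.1, this.2]
  let c : Option (Fin q) → Finset (Fin m) → ℕ := fun t A =>
    (Finset.univ.filter fun x : Fin d => f (t, x) ∈ A).card
  let σ : Option (Fin q) → Equiv.Perm (Fin m) := fun j =>
    Equiv.Perm.viaEmbedding ((Equiv.swap none j).prodCongr (Equiv.refl (Fin d))) ⟨f, hf⟩
  have hc : ∀ j t A, c (Equiv.swap none j t) (A.map (σ j).toEmbedding) = c t A := by
    intro j t A
    refine congrArg Finset.card (Finset.filter_congr fun x _ => ?_)
    have h1 : f (Equiv.swap none j t, x) = σ j (f (t, x)) :=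
      (Equiv.Perm.viaEmbedding_apply
        ((Equiv.swap none j).prodCongr (Equiv.refl (Fin d))) ⟨f, hf⟩ (t, x)).symm
    rw [h1, Finset.mem_map_equiv, Equiv.symm_apply_apply]
  have hnone : ∀ A, (A ∩ (W' \ W)).card ≤ c none A := by
    intro A
    refine Finset.card_le_card_of_surjOn (fun x => f (none, x)) ?_
    intro y hy
    rw [Finset.mem_coe, Finset.mem_inter] at hy
    have e : f (none, g0.symm ⟨y, hy.2⟩) = y :=
      congrArg Subtype.val (g0.apply_symm_apply ⟨y, hy.2⟩)
    refine ⟨g0.symm ⟨y, hy.2⟩, ?_, e⟩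
    rw [Finset.mem_coe, Finset.mem_filter, e]
    exact ⟨Finset.mem_univ _, hy.1⟩
  have hsome : ∀ t A, c (some t) A ≤ (A ∩ (W \ W')).card := by
    intro t A
    refine Finset.card_le_card_of_injOn (fun x => f (some t, x)) ?_ ?_
    · intro x hx
      rw [Finset.mem_coe, Finset.mem_filter] at hx
      rw [Finset.mem_coe, Finset.mem_inter]
      exact ⟨hx.2, (g1 (t, x)).2⟩
    · intro x _ y _ hxy
      exact (Prod.mk.inj (hf hxy)).2
  have hpref : ∀ A : Finset (Fin m), (A ∩ W).card < (A ∩ W').card →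
      ∀ t, t ≠ none → c t A < c none A := by
    rintro A hA (_ | t) ht
    · exact absurd rfl ht
    · have h1 : ∀ U V : Finset (Fin m),
          (A ∩ (U \ V)).card + (A ∩ (U ∩ V)).card = (A ∩ U).card := by
        intro U V
        have := Finset.card_sdiff_add_card_inter (A ∩ U) V
        rwa [Finset.inter_sdiff_assoc, Finset.inter_assoc] at this
      have h2 := h1 W W'
      have h3 := h1 W' W
      rw [Finset.inter_comm W' W] at h3
      have h4 := hnone A
      have h5 := hsome t A
      omega
  have h := card_mul_icMass_le hp0 hp1 (fun A => (A ∩ W).card < (A ∩ W').card) σ 1 ?_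
  · have hW : (0 : ℝ) < W.card := by exact_mod_cast h0.trans hle
    have hlt : (W.card : ℝ) < W'.card * (q + 1) := by
      have := Nat.lt_mul_div_succ W.card (show 0 < W'.card from h0)
      exact_mod_cast this
    simp only [Fintype.card_option, Fintype.card_fin, Nat.cast_add, Nat.cast_one] at h
    have hq1 : (0 : ℝ) < q + 1 := by positivity
    calc _ ≤ 1 / ((q : ℝ) + 1) := by rw [le_div_iff₀ hq1]; linarith
      _ < _ := by rw [div_lt_div_iff₀ hq1 hW]; linarith
  · intro A T hT
    rw [Finset.card_le_one]
    have key : ∀ i j : Option (Fin q), i ≠ j →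
        (A.map (σ i).toEmbedding ∩ W).card < (A.map (σ i).toEmbedding ∩ W').card →
        c j A < c i A := by
      intro i j hij hi
      have h1 := hpref _ hi (Equiv.swap none i j) (by
        intro e
        exact hij ((Equiv.swap none i).injective
          ((Equiv.swap_apply_right none i).trans e.symm)))
      rw [hc] at h1
      have h2 := hc i i A
      rw [Equiv.swap_apply_right] at h2
      rwa [h2] at h1
    intro i hi j hj
    by_contra hij
    exact absurd (key i j hij (hT i hi)) (key j i (Ne.symm hij) (hT j hj)).not_gt

open Classical in
/-- A Chernoff bound for the number of agents whose preference satisfies `Q`. -/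
lemma prIC_count_le {m : ℕ} {p : ℝ} (hp0 : 0 < p) (hp1 : p < 1)
    (Q : Finset (Fin m) → Prop) (t : ℝ) (ht1 : t ≤ 1) (hQ : icMass m p Q < t) (n : ℕ) :
    prIC m n p (fun P => t * n ≤ ((Finset.univ.filter fun j => Q (P j)).card : ℝ)) ≤
      Real.exp (-(((t - icMass m p Q) / 2) ^ 2 * n)) := by
  have hμ0 : 0 ≤ icMass m p Q := by
    refine Finset.sum_nonneg fun A _ => ?_
    split_ifs
    exacts [(icProb_pos hp0 hp1 A).le, le_rfl]
  set μ := icMass m p Q with hμ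
  set s := (t - μ) / 2 with hs
  have hs0 : 0 < s := by rw [hs]; linarith
  have hs1 : s ≤ 1 := by rw [hs]; linarith
  let x : Finset (Fin m) → ℝ := fun A => (if Q A then 1 else 0) - t
  have hx : ∀ A, |x A| ≤ 1 := by
    intro A
    simp only [x]
    rw [abs_le]
    split_ifs <;> constructor <;> linarith
  have hmean : ∑ A, icProb m p A * x A = μ - t := by
    simp only [x, mul_sub, Finset.sum_sub_distrib, ← Finset.sum_mul, sum_icProb, hμ, icMass]
    simp
  have hmgf : ∑ A, icProb m p A * Real.exp (s * x A) ≤ Real.exp (-s ^ 2) := by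
    calc ∑ A, icProb m p A * Real.exp (s * x A)
        ≤ ∑ A, icProb m p A * (1 + s * x A + s ^ 2) := by
          refine Finset.sum_le_sum fun A _ => ?_
          refine mul_le_mul_of_nonneg_left ?_ (icProb_pos hp0 hp1 A).le
          have h1 : |s * x A| ≤ 1 := by
            rw [abs_mul, abs_of_pos hs0]
            exact mul_le_one₀ hs1 (abs_nonneg _) (hx A)
          have h2 := (abs_le.1 (Real.abs_exp_sub_one_sub_id_le h1)).2
          have h3 : (x A) ^ 2 ≤ 1 := by
            rw [← sq_abs]; exact pow_le_one₀ (abs_nonneg _) (hx A)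
          nlinarith [sq_nonneg s]
      _ = (1 + s ^ 2) * ∑ A, icProb m p A + s * ∑ A, icProb m p A * x A := by
          rw [Finset.mul_sum, Finset.mul_sum, ← Finset.sum_add_distrib]
          exact Finset.sum_congr rfl fun A _ => by ring
      _ = -s ^ 2 + 1 := by rw [sum_icProb, hmean, hs]; ring
      _ ≤ Real.exp (-s ^ 2) := Real.add_one_le_exp _
  calc _ ≤ ∑ P : Fin n → Finset (Fin m), ∏ j, icProb m p (P j) * Real.exp (s * x (P j)) := by
        unfold prIC
        refine Finset.sum_le_sum fun P _ => ?_
        have hnn : 0 ≤ ∏ j, icProb m p (P j) :=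
          Finset.prod_nonneg fun j _ => (icProb_pos hp0 hp1 _).le
        rw [Finset.prod_mul_distrib, ← Real.exp_sum, ← Finset.mul_sum]
        split_ifs with h
        · refine le_mul_of_one_le_right hnn (Real.one_le_exp (mul_nonneg hs0.le ?_))
          simp only [x, Finset.sum_sub_distrib, Finset.sum_boole, Finset.sum_const,
            Finset.card_univ, Fintype.card_fin, nsmul_eq_mul]
          linarith
        · positivity
    _ = (∑ A, icProb m p A * Real.exp (s * x A)) ^ n :=
        sum_prod_eq_pow m n fun A => icProb m p A * Real.exp (s * x A)
    _ ≤ Real.exp (-s ^ 2) ^ n := by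
        refine pow_le_pow_left₀ (Finset.sum_nonneg fun A _ => ?_) hmgf n
        exact mul_nonneg (icProb_pos hp0 hp1 A).le (Real.exp_pos _).le
    _ = _ := by rw [← Real.exp_nat_mul]; congr 1; ring

lemma prIC_le_sum {m n : ℕ} {p : ℝ} (hp0 : 0 < p) (hp1 : p < 1) {ι : Type*} [Fintype ι]
    (Ev : (Fin n → Finset (Fin m)) → Prop) (F : ι → (Fin n → Finset (Fin m)) → Prop)
    (h : ∀ P, Ev P → ∃ i, F i P) : prIC m n p Ev ≤ ∑ i, prIC m n p (F i) := by
  classical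
  unfold prIC
  rw [Finset.sum_comm]
  refine Finset.sum_le_sum fun P _ => ?_
  have hnn : 0 ≤ ∏ j, icProb m p (P j) :=
    Finset.prod_nonneg fun j _ => (icProb_pos hp0 hp1 _).le
  have hterm : ∀ i ∈ Finset.univ, 0 ≤ if F i P then ∏ j, icProb m p (P j) else 0 := by
    intro i _
    split_ifs
    exacts [hnn, le_rfl]
  split_ifs with hP
  · obtain ⟨i, hi⟩ := h P hP
    refine le_trans ?_ (Finset.single_le_sum hterm (Finset.mem_univ i))
    rw [if_pos hi]
  · exact Finset.sum_nonneg hterm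

lemma pow_icProb_le_prIC {m n : ℕ} {p : ℝ} (hp0 : 0 < p) (hp1 : p < 1)
    (Ev : (Fin n → Finset (Fin m)) → Prop) (A : Finset (Fin m)) (h : Ev fun _ => A) :
    icProb m p A ^ n ≤ prIC m n p Ev := by
  classical
  unfold prIC
  have hterm : ∀ P ∈ (Finset.univ : Finset (Fin n → Finset (Fin m))),
      0 ≤ if Ev P then ∏ j, icProb m p (P j) else 0 := by
    intro P _
    split_ifs
    exacts [Finset.prod_nonneg fun j _ => (icProb_pos hp0 hp1 _).le, le_rfl]
  refine le_trans ?_ (Finset.single_le_sum hterm (Finset.mem_univ fun _ => A))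
  simp [h]

open Classical in
/-- An event that contains the constant profiles of some preference `A₀`, and that forces one of
finitely many properties to be overrepresented among the agents, has probability `exp(-Θ(n))`. -/
lemma prIC_exp_theta {m : ℕ} {p : ℝ} (hp0 : 0 < p) (hp1 : p < 1) {ι : Type*} [Finite ι]
    (Ev : ∀ n, (Fin n → Finset (Fin m)) → Prop) (A₀ : Finset (Fin m))
    (hA₀ : ∀ n, 1 ≤ n → Ev n fun _ => A₀) (Q : ι → Finset (Fin m) → Prop) (t : ι → ℝ)
    (ht1 : ∀ i, t i ≤ 1) (hQ : ∀ i, icMass m p (Q i) < t i)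
    (hEv : ∀ n, 1 ≤ n → ∀ P, Ev n P →
      ∃ i, t i * n ≤ ((Finset.univ.filter fun j => Q i (P j)).card : ℝ)) :
    ∃ c₁ c₂ : ℝ, c₂ ≤ c₁ ∧ 0 < c₂ ∧ ∃ N : ℕ, ∀ n : ℕ, N ≤ n →
      Real.exp (-(c₁ * n)) ≤ prIC m n p (Ev n) ∧ prIC m n p (Ev n) ≤ Real.exp (-(c₂ * n)) := by
  have := Fintype.ofFinite ι
  obtain ⟨c, hc0, hc⟩ : ∃ c : ℝ, 0 < c ∧ ∀ i, 2 * c ≤ ((t i - icMass m p (Q i)) / 2) ^ 2 := by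
    rcases isEmpty_or_nonempty ι with hι | hι
    · exact ⟨1, one_pos, fun i => hι.elim i⟩
    · obtain ⟨i, hi⟩ := Finite.exists_min fun i => ((t i - icMass m p (Q i)) / 2) ^ 2
      have hpos : 0 < ((t i - icMass m p (Q i)) / 2) ^ 2 := by
        have := sub_pos.2 (hQ i)
        positivity
      exact ⟨((t i - icMass m p (Q i)) / 2) ^ 2 / 2, by positivity, fun j => by
        have := hi j
        linarith⟩
  have hr := icProb_pos hp0 hp1 A₀
  obtain ⟨N, hN⟩ := exists_nat_ge ((Fintype.card ι : ℝ) / c)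
  refine ⟨max c (-Real.log (icProb m p A₀)), c, le_max_left _ _, hc0, N + 1, fun n hn => ⟨?_, ?_⟩⟩
  · refine le_trans ?_ (pow_icProb_le_prIC hp0 hp1 (Ev n) A₀ (hA₀ n (by omega)))
    rw [← Real.exp_log (pow_pos hr n), Real.log_pow, Real.exp_le_exp]
    have h1 := le_max_right c (-Real.log (icProb m p A₀))
    have h2 : (0 : ℝ) ≤ n := n.cast_nonneg
    nlinarith
  · calc prIC m n p (Ev n)
        ≤ ∑ i, prIC m n p
            (fun P => t i * n ≤ ((Finset.univ.filter fun j => Q i (P j)).card : ℝ)) :=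
          prIC_le_sum hp0 hp1 _ _ (hEv n (by omega))
      _ ≤ ∑ _i : ι, Real.exp (-(2 * c * n)) := by
          refine Finset.sum_le_sum fun i _ => ?_
          refine (prIC_count_le hp0 hp1 (Q i) (t i) (ht1 i) (hQ i) n).trans ?_
          rw [Real.exp_le_exp]
          have := hc i
          gcongr
      _ = Fintype.card ι * Real.exp (-(2 * c * n)) := by simp
      _ ≤ Real.exp (c * n) * Real.exp (-(2 * c * n)) := by
          gcongr
          have h1 : (N : ℝ) ≤ n := by exact_mod_cast (Nat.le_succ N).trans hn
          have h2 := (div_le_iff₀ hc0).1 (hN.trans h1)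
          have h3 := Real.add_one_le_exp (c * n)
          linarith
      _ = Real.exp (-(c * n)) := by rw [← Real.exp_add]; congr 1; ring

/-- under `p`-Impartial Culture, the probability that some
`k`-committee fails to be in the core is `exp(−Θ(n))`, and likewise the probability
that some `k`-committee fails EJR+ is `exp(−Θ(n))`; equivalently, with probability
`1 − exp(−Θ(n))` every `k`-committee is in the core (resp. satisfies EJR+). -/
theorem core_ejrplus_impartial_culture (m k : ℕ) (hk : 1 ≤ k) (hkm : k < m)
    (p : ℝ) (hp0 : 0 < p) (hp1 : p < 1) :
    (∃ c₁ c₂ : ℝ, c₂ ≤ c₁ ∧ 0 < c₂ ∧ ∃ N : ℕ, ∀ n : ℕ, N ≤ n →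
      Real.exp (-(c₁ * n)) ≤
        prIC m n p (fun P => ¬ ∀ W : Finset (Fin m), W.card = k → inCore m k n P W) ∧
      prIC m n p (fun P => ¬ ∀ W : Finset (Fin m), W.card = k → inCore m k n P W)
        ≤ Real.exp (-(c₂ * n))) ∧
    (∃ c₁ c₂ : ℝ, c₂ ≤ c₁ ∧ 0 < c₂ ∧ ∃ N : ℕ, ∀ n : ℕ, N ≤ n →
      Real.exp (-(c₁ * n)) ≤
        prIC m n p
          (fun P => ¬ ∀ W : Finset (Fin m), W.card = k → inEJRplus m k n P W) ∧
      prIC m n p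
          (fun P => ¬ ∀ W : Finset (Fin m), W.card = k → inEJRplus m k n P W)
        ≤ Real.exp (-(c₂ * n))) := by
  classical
  have hk' : (0 : ℝ) < k := by exact_mod_cast hk
  obtain ⟨W₀, hW₀⟩ : ∃ W : Finset (Fin m), W.card = k := by
    obtain ⟨W, -, hW⟩ := Finset.exists_subset_card_eq
      (s := (Finset.univ : Finset (Fin m))) (n := k) (by simpa using hkm.le)
    exact ⟨W, hW⟩
  obtain ⟨a₀, ha₀⟩ : ∃ a, a ∉ W₀ := by
    by_contra! h
    have := Finset.card_le_card (fun x _ => h x : (Finset.univ : Finset (Fin m)) ⊆ W₀)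
    simp only [Finset.card_univ, Fintype.card_fin] at this
    omega
  have hcast : ∀ {ℓ n c : ℕ}, ℓ * n ≤ c * k → (ℓ : ℝ) / k * n ≤ c := by
    intro ℓ n c h
    rw [div_mul_eq_mul_div, div_le_iff₀ hk']
    exact_mod_cast h
  constructor
  · refine prIC_exp_theta hp0 hp1
      (ι := {x : Finset (Fin m) × Finset (Fin m) //
        x.1.card = k ∧ 1 ≤ x.2.card ∧ x.2.card ≤ k})
      _ {a₀} ?_ (fun x A => (A ∩ x.1.1).card < (A ∩ x.1.2).card)
      (fun x => (x.1.2.card : ℝ) / k) ?_ ?_ ?_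
    · intro n hn h
      have : Nonempty (Fin n) := ⟨⟨0, hn⟩⟩
      obtain ⟨j, -, hj⟩ := h W₀ hW₀ Finset.univ {a₀} Finset.univ_nonempty (by
        simpa using Nat.le_mul_of_pos_right n hk)
      simp [Finset.singleton_inter_of_notMem ha₀] at hj
    · rintro ⟨x, hx⟩
      rw [div_le_one hk']
      exact_mod_cast hx.2.2
    · rintro ⟨⟨W, W'⟩, rfl, h0, hle⟩
      exact icMass_prefers_lt hp0 hp1 W W' h0 hle
    · intro n hn P h
      simp only [inCore] at h
      push Not at h
      obtain ⟨W, hW, S, W', hS, hcard, hpref⟩ := h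
      have hSn : S.card ≤ n := by simpa using Finset.card_le_univ S
      refine ⟨⟨(W, W'), hW, ?_, ?_⟩, ?_⟩
      · obtain ⟨j, hj⟩ := hS
        have h1 := hpref j hj
        exact (Nat.zero_lt_of_lt h1).trans_le (Finset.card_le_card Finset.inter_subset_right)
      · have h1 : W'.card * n ≤ k * n := by nlinarith
        exact Nat.le_of_mul_le_mul_right h1 hn
      · refine (hcast hcard).trans ?_
        exact_mod_cast Finset.card_le_card fun j hj => by simpa using hpref j hj
  · refine prIC_exp_theta hp0 hp1
      (ι := {x : Finset (Fin m) × Fin m × Fin (k + 1) //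
        x.1.card = k ∧ x.2.1 ∉ x.1 ∧ 1 ≤ (x.2.2 : ℕ)})
      _ {a₀} ?_ (fun x A => x.1.2.1 ∈ A ∧ (A ∩ x.1.1).card < x.1.2.2)
      (fun x => ((x.1.2.2 : ℕ) : ℝ) / k) ?_ ?_ ?_
    · intro n hn h
      refine h W₀ hW₀ ⟨a₀, ha₀, 1, le_rfl, hk, Finset.univ, ?_, fun j _ => ?_⟩
      · simpa using Nat.le_mul_of_pos_right n hk
      · simp [Finset.singleton_inter_of_notMem ha₀]
    · rintro ⟨x, hx⟩
      rw [div_le_one hk']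
      exact_mod_cast Nat.lt_succ_iff.1 x.2.2.2
    · rintro ⟨⟨W, a, ℓ⟩, hW, ha, hℓ⟩
      exact icMass_ejrplus_lt hk hℓ hp0 hp1 W hW a ha
    · intro n _ P h
      simp only [inEJRplus] at h
      push Not at h
      obtain ⟨W, hW, a, ha, ℓ, hℓ, hℓk, S, hcard, hS⟩ := h
      refine ⟨⟨(W, a, ⟨ℓ, Nat.lt_succ_iff.2 hℓk⟩), hW, ha, hℓ⟩, ?_⟩
      refine (hcast hcard).trans ?_
      exact_mod_cast Finset.card_le_card fun j hj => by simpa using hS j hj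
end

section
/- For any fixed m, fixed 1 ≤ k ≤ m, fixed p⃗ ∈ (0,1)^m, and any Thiele method Thiele_s with integer, nondecreasing, nonconstant scoring vector s, the following dichotomy holds: if |top_k(p⃗)| = 1, then there exist constants c, C > 0 such that for all n ≥ 1, Pr_{P∼(π_{p⃗})^n}( |Thiele_s(P)| = 1 ) ≥ 1 − C·e^{−c·n}; otherwise (|top_k(p⃗)| ≥ 2), there exist constants c₁, c₂ > 0 and N such that for all n ≥ N, c₁/√n ≤ Pr_{P∼(π_{p⃗})^n}( |Thiele_s(P)| ≥ 2 ) ≤ c₂/√n. -/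
/-- Probability of an approval set `A` under the independent approval distribution
`π_{p⃗}`: each alternative `i` is approved independently with probability `p i`. -/
noncomputable def iadProb (m : ℕ) (p : Fin m → ℝ) (A : Finset (Fin m)) : ℝ :=
  (∏ i ∈ A, p i) * ∏ i ∈ Aᶜ, (1 - p i)

open Classical in
/-- Probability that a profile of `n` i.i.d. `π_{p⃗}` approval preferences satisfies
the event `Ev`. -/
noncomputable def prIAD (m n : ℕ) (p : Fin m → ℝ)
    (Ev : (Fin n → Finset (Fin m)) → Prop) : ℝ :=
  ∑ P : Fin n → Finset (Fin m), if Ev P then ∏ j, iadProb m p (P j) else 0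

/-- The (integer) Thiele score of committee `W` at profile `P`. -/
def thieleScoreZ {m : ℕ} (s : ℕ → ℤ) {n : ℕ} (P : Fin n → Finset (Fin m))
    (W : Finset (Fin m)) : ℤ :=
  ∑ j, s ((P j ∩ W).card)

/-- The set of winning `k`-committees under the Thiele method with integer score
vector `s`. -/
def thieleWinnersZ (m k : ℕ) (s : ℕ → ℤ) {n : ℕ}
    (P : Fin n → Finset (Fin m)) : Finset (Finset (Fin m)) :=
  Finset.univ.filter fun W => W.card = k ∧
    ∀ W' : Finset (Fin m), W'.card = k → thieleScoreZ s P W' ≤ thieleScoreZ s P W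

open Classical in
/-- The set `top_k(p⃗)` of `k`-committees whose approval probabilities dominate all
others. -/
noncomputable def topk (m k : ℕ) (p : Fin m → ℝ) : Finset (Finset (Fin m)) :=
  Finset.univ.filter fun W : Finset (Fin m) => W.card = k ∧
    ∀ i ∈ W, ∀ j : Fin m, j ∉ W → p j ≤ p i

/-- The probability that `n` independent draws from the weights `w` satisfy `Ev`. -/
noncomputable def iidPr {α : Type*} [Fintype α] (w : α → ℝ) (n : ℕ)
    (Ev : (Fin n → α) → Prop) : ℝ :=
  open Classical in ∑ P : Fin n → α, if Ev P then ∏ j, w (P j) else 0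

section IID

variable {α : Type*} [Fintype α] {w : α → ℝ}

theorem iidPr_mono (hw : ∀ a, 0 ≤ w a) {n : ℕ} {E F : (Fin n → α) → Prop}
    (h : ∀ P, E P → F P) : iidPr w n E ≤ iidPr w n F := by
  classical
  refine Finset.sum_le_sum fun P _ => ?_
  have := Finset.prod_nonneg fun j (_ : j ∈ Finset.univ) => hw (P j)
  by_cases hE : E P
  · simp [hE, h P hE]
  · by_cases hF : F P <;> simp [hE, hF, this]

theorem iidPr_nonneg (hw : ∀ a, 0 ≤ w a) {n : ℕ} (E : (Fin n → α) → Prop) :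
    0 ≤ iidPr w n E := by
  refine Finset.sum_nonneg fun P _ => ?_
  have := Finset.prod_nonneg fun j (_ : j ∈ Finset.univ) => hw (P j)
  split_ifs <;> simp [this]

theorem iidPr_true (hw1 : ∑ a, w a = 1) (n : ℕ) : iidPr w n (fun _ => True) = 1 := by
  simp [iidPr, ← Fintype.sum_pow, hw1]

theorem iidPr_or_le (hw : ∀ a, 0 ≤ w a) {n : ℕ} (E F : (Fin n → α) → Prop) :
    iidPr w n (fun P => E P ∨ F P) ≤ iidPr w n E + iidPr w n F := by
  classical
  rw [iidPr, iidPr, iidPr, ← Finset.sum_add_distrib]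
  refine Finset.sum_le_sum fun P _ => ?_
  have := Finset.prod_nonneg fun j (_ : j ∈ Finset.univ) => hw (P j)
  by_cases hE : E P <;> by_cases hF : F P <;> simp [hE, hF, this]

theorem iidPr_exists_le (hw : ∀ a, 0 ≤ w a) {ι : Type*} (t : Finset ι) {n : ℕ}
    (E : ι → (Fin n → α) → Prop) :
    iidPr w n (fun P => ∃ i ∈ t, E i P) ≤ ∑ i ∈ t, iidPr w n (E i) := by
  classical
  induction t using Finset.induction_on with
  | empty => simp [iidPr]
  | insert a t ha ih =>
    rw [Finset.sum_insert ha]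
    refine le_trans (iidPr_mono hw fun P => ?_)
      ((iidPr_or_le hw (E a) (fun P => ∃ i ∈ t, E i P)).trans (by gcongr))
    simp

theorem one_sub_le_iidPr (hw : ∀ a, 0 ≤ w a) (hw1 : ∑ a, w a = 1) {n : ℕ}
    (E F : (Fin n → α) → Prop) (h : ∀ P, ¬ E P → F P) :
    1 - iidPr w n E ≤ iidPr w n F := by
  have h1 := iidPr_mono hw (n := n) (E := fun _ => True) (F := fun P => E P ∨ F P)
    fun P _ => by by_cases hE : E P <;> simp [hE, h]
  have h2 := iidPr_or_le hw E F
  rw [iidPr_true hw1] at h1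
  linarith

theorem iidPr_le_sum_mul (hw : ∀ a, 0 ≤ w a) {n : ℕ} (E : (Fin n → α) → Prop)
    (f : (Fin n → α) → ℝ) (hf : ∀ P, 0 ≤ f P) (hE : ∀ P, E P → 1 ≤ f P) :
    iidPr w n E ≤ ∑ P : Fin n → α, f P * ∏ j, w (P j) := by
  refine Finset.sum_le_sum fun P _ => ?_
  have := Finset.prod_nonneg fun j (_ : j ∈ Finset.univ) => hw (P j)
  split_ifs with h
  · exact le_mul_of_one_le_left this (hE P h)
  · exact mul_nonneg (hf P) this

/-- A Chernoff bound for a variable of negative mean. -/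
theorem exists_iidPr_nonneg_sum_le_pow (hw : ∀ a, 0 ≤ w a) (hw1 : ∑ a, w a = 1)
    (X : α → ℝ) (hX : ∑ a, w a * X a < 0) :
    ∃ r : ℝ, 0 < r ∧ r < 1 ∧ ∀ n, iidPr w n (fun P => 0 ≤ ∑ j, X (P j)) ≤ r ^ n := by
  obtain ⟨B, hB⟩ := Finite.exists_le fun a => |X a|
  set M := max B 1 with hM
  have hM1 : 1 ≤ M := le_max_right _ _
  have hXM : ∀ a, |X a| ≤ M := fun a => (hB a).trans (le_max_left _ _)
  set μ := ∑ a, w a * X a with hμ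
  obtain ⟨l, hl0, hl1, hl2⟩ : ∃ l : ℝ, 0 < l ∧ l * M ≤ 1 ∧ l * μ + l ^ 2 * M ^ 2 < 0 := by
    refine ⟨min (1 / M) (-μ / (2 * M ^ 2)), ?_, ?_, ?_⟩
    · have : 0 < -μ := by linarith
      positivity
    · calc _ ≤ 1 / M * M := by gcongr; exact min_le_left _ _
        _ = 1 := by field_simp
    · set l := min (1 / M) (-μ / (2 * M ^ 2)) with hl
      have h0 : 0 < l := by
        have : 0 < -μ := by linarith
        positivity
      have h1 : l ≤ -μ / (2 * M ^ 2) := min_le_right _ _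
      rw [le_div_iff₀ (by positivity)] at h1
      nlinarith
  have hmgf : ∑ a, Real.exp (l * X a) * w a ≤ 1 + l * μ + l ^ 2 * M ^ 2 := by
    calc ∑ a, Real.exp (l * X a) * w a
        ≤ ∑ a, (1 + l * X a + l ^ 2 * M ^ 2) * w a := by
          refine Finset.sum_le_sum fun a _ => mul_le_mul_of_nonneg_right ?_ (hw a)
          have h1 : |l * X a| ≤ 1 := by
            rw [abs_mul, abs_of_pos hl0]
            exact (mul_le_mul_of_nonneg_left (hXM a) hl0.le).trans hl1
          have h2 := (abs_le.1 (Real.abs_exp_sub_one_sub_id_le h1)).2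
          have h3 : X a ^ 2 ≤ M ^ 2 := sq_le_sq.2 (by
            rw [abs_of_pos (by positivity : 0 < M)]; exact hXM a)
          nlinarith [sq_nonneg l]
      _ = ∑ a, (w a + l * (w a * X a) + l ^ 2 * M ^ 2 * w a) :=
          Finset.sum_congr rfl fun a _ => by ring
      _ = 1 + l * μ + l ^ 2 * M ^ 2 := by
          rw [Finset.sum_add_distrib, Finset.sum_add_distrib, ← Finset.mul_sum,
            ← Finset.mul_sum, hw1, ← hμ, mul_one]
  have hpos : 0 < ∑ a, Real.exp (l * X a) * w a := by
    obtain ⟨a, -, ha⟩ := Finset.exists_ne_zero_of_sum_ne_zero (by rw [hw1]; norm_num : ∑ a, w a ≠ 0)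
    exact Finset.sum_pos' (fun a _ => mul_nonneg (Real.exp_pos _).le (hw a))
      ⟨a, Finset.mem_univ _, mul_pos (Real.exp_pos _) ((hw a).lt_of_ne' ha)⟩
  refine ⟨_, hpos, by linarith, fun n => ?_⟩
  refine (iidPr_le_sum_mul hw _ (fun P => Real.exp (l * ∑ j, X (P j)))
    (fun P => (Real.exp_pos _).le) fun P hP => Real.one_le_exp (by positivity)).trans_eq ?_
  rw [Fintype.sum_pow]
  refine Finset.sum_congr rfl fun P _ => ?_
  rw [Finset.mul_sum, Real.exp_sum, Finset.prod_mul_distrib]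

theorem sum_prod_mul_sq_sum (hw1 : ∑ a, w a = 1) (X : α → ℝ) (hX : ∑ a, w a * X a = 0)
    (n : ℕ) : ∀ y : ℝ, ∑ P : Fin n → α, (y + ∑ j, X (P j)) ^ 2 * ∏ j, w (P j) =
      y ^ 2 + n * ∑ a, w a * X a ^ 2 := by
  induction n with
  | zero => simp
  | succ n ih =>
    intro y
    rw [← (Fin.consEquiv fun _ => α).sum_comp, Fintype.sum_prod_type]
    simp only [Fin.consEquiv_apply, Fin.sum_univ_succ, Fin.prod_univ_succ, Fin.cons_zero,
      Fin.cons_succ]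
    have : ∀ a, ∑ P : Fin n → α, (y + (X a + ∑ j, X (P j))) ^ 2 * (w a * ∏ j, w (P j)) =
        w a * ((y + X a) ^ 2 + n * ∑ a, w a * X a ^ 2) := fun a => by
      rw [← ih, Finset.mul_sum]
      exact Finset.sum_congr rfl fun P _ => by ring
    rw [Finset.sum_congr rfl fun a _ => this a]
    calc _ = ∑ a, ((y ^ 2 + n * ∑ a, w a * X a ^ 2) * w a + 2 * y * (w a * X a)
          + w a * X a ^ 2) := Finset.sum_congr rfl fun a _ => by ring
      _ = _ := by
        rw [Finset.sum_add_distrib, Finset.sum_add_distrib, ← Finset.mul_sum, ← Finset.mul_sum,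
          hw1, hX]
        push_cast
        ring

/-- Chebyshev's inequality for a centred variable. -/
theorem iidPr_lt_sq_sum_le (hw : ∀ a, 0 ≤ w a) (hw1 : ∑ a, w a = 1) (X : α → ℝ)
    (hX : ∑ a, w a * X a = 0) (n : ℕ) {t : ℝ} (ht : 0 < t) :
    iidPr w n (fun P => t < (∑ j, X (P j)) ^ 2) ≤ n * (∑ a, w a * X a ^ 2) / t := by
  refine (iidPr_le_sum_mul hw _ (fun P => (0 + ∑ j, X (P j)) ^ 2 / t) (fun P => by positivity)
    fun P hP => ?_).trans_eq ?_
  · rw [zero_add, one_le_div ht]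
    exact hP.le
  · have := sum_prod_mul_sq_sum hw1 X hX n 0
    simp_rw [div_mul_eq_mul_div]
    rw [← Finset.sum_div, this]
    simp

/-- If two independent copies are distributed symmetrically, they cancel at least as often as
Cauchy-Schwarz predicts. -/
theorem sq_sum_le_mul_sum_cancel {β : Type*} [Fintype β] (u : β → ℝ) (hu : ∀ x, 0 ≤ u x)
    (D : β → ℤ) (G : β → Prop) [DecidablePred G] (φ : β ≃ β) (hφu : ∀ x, u (φ x) = u x)
    (hφD : ∀ x, D (φ x) = -D x) (hφG : ∀ x, G x → G (φ x)) (L : ℕ) :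
    (∑ x, if G x ∧ |D x| ≤ L then u x else 0) ^ 2 ≤
      (2 * L + 1) * ∑ x, ∑ y, if G x ∧ G y ∧ D x + D y = 0 then u x * u y else 0 := by
  classical
  set I := Finset.Icc (-(L : ℤ)) L
  set f : ℤ → ℝ := fun z => ∑ x, if G x ∧ D x = z then u x else 0
  have h1 : (∑ x, if G x ∧ |D x| ≤ L then u x else 0) = ∑ z ∈ I, f z := by
    rw [Finset.sum_comm]
    refine Finset.sum_congr rfl fun x _ => ?_
    by_cases hG : G x
    · simp [hG, I, abs_le]
    · simp [hG]
  have h2 : ∑ z ∈ I, f z ^ 2 ≤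
      ∑ x, ∑ y, if G x ∧ G y ∧ D x + D y = 0 then u x * u y else 0 := by
    have e : ∀ z, f z ^ 2 =
        ∑ x, ∑ y, if G x ∧ D x = z ∧ G y ∧ D y = z then u x * u y else 0 := fun z => by
      rw [sq, Finset.sum_mul_sum]
      refine Finset.sum_congr rfl fun x _ => Finset.sum_congr rfl fun y _ => ?_
      by_cases a : G x <;> by_cases b : D x = z <;> by_cases c : G y <;>
        by_cases d : D y = z <;> simp [a, b, c, d]
    simp_rw [e]
    rw [Finset.sum_comm]
    refine Finset.sum_le_sum fun x _ => ?_
    rw [Finset.sum_comm, ← φ.sum_comp fun y =>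
      if G x ∧ G y ∧ D x + D y = 0 then u x * u y else 0]
    refine Finset.sum_le_sum fun y _ => ?_
    have h0 : 0 ≤ u x * u y := mul_nonneg (hu x) (hu y)
    rw [hφu, hφD]
    by_cases hxy : G x ∧ G y ∧ D x = D y
    · obtain ⟨hx, hy, hD⟩ := hxy
      simp only [hx, hy, hφG y hy, hD, true_and, and_self, add_neg_cancel, if_true]
      rw [Finset.sum_ite_eq]
      split_ifs <;> simp [h0]
    · rw [Finset.sum_eq_zero fun z _ => if_neg fun h =>
        hxy ⟨h.1, h.2.2.1, h.2.1.trans h.2.2.2.symm⟩]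
      split_ifs <;> simp [h0]
  rw [h1]
  refine sq_sum_le_card_mul_sum_sq.trans ?_
  have : (I.card : ℝ) = 2 * L + 1 := by
    simp only [I, Int.card_Icc]
    have : ((L : ℤ) + 1 - -(L : ℤ)).toNat = 2 * L + 1 := by omega
    rw [this]; push_cast; ring
  rw [this]
  gcongr

end IID

section Concentration

open Complex in
theorem integral_exp_int_mul_I (z : ℤ) :
    ∫ t in (-Real.pi)..Real.pi, exp (z * I * t) = if z = 0 then 2 * (Real.pi : ℂ) else 0 := by
  split_ifs with h
  · simp [h]; ring
  · have hz : (z : ℂ) * I ≠ 0 := mul_ne_zero (by exact_mod_cast h) I_ne_zero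
    rw [integral_exp_mul_complex hz, div_eq_zero_iff, sub_eq_zero]
    left
    rw [exp_eq_exp_iff_exists_int]
    exact ⟨z, by push_cast; ring⟩

theorem integral_comp_int_mul_of_periodic {g : ℝ → ℝ} (hg : Continuous g)
    (hper : Function.Periodic g (2 * Real.pi)) {d : ℤ} (hd : d ≠ 0) :
    ∫ t in (-Real.pi)..Real.pi, g (d * t) = ∫ t in (-Real.pi)..Real.pi, g t := by
  have hd' : (d : ℝ) ≠ 0 := by exact_mod_cast hd
  rw [intervalIntegral.integral_comp_mul_left g hd']
  have h1 := hper.intervalIntegral_add_zsmul_eq d (d * -Real.pi)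
    fun a b => hg.intervalIntegrable a b
  have h2 := hper.intervalIntegral_add_eq (d * -Real.pi) (-Real.pi)
  rw [h2] at h1
  have e1 : (d : ℝ) * -Real.pi + d • (2 * Real.pi) = d * Real.pi := by
    rw [zsmul_eq_mul]; ring
  have e2 : -Real.pi + 2 * Real.pi = Real.pi := by ring
  rw [e1, e2] at h1
  rw [h1, zsmul_eq_mul, smul_eq_mul, inv_mul_cancel_left₀ hd']

theorem integral_exp_neg_mul_one_sub_cos_le {b : ℝ} (hb : 0 < b) :
    ∫ t in (-Real.pi)..Real.pi, Real.exp (-(b * (1 - Real.cos t))) ≤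
      √(Real.pi / (b * (2 / Real.pi ^ 2))) := by
  have hpi := Real.pi_pos
  have hb' : 0 < b * (2 / Real.pi ^ 2) := by positivity
  rw [← integral_gaussian]
  calc _ ≤ ∫ t in (-Real.pi)..Real.pi, Real.exp (-(b * (2 / Real.pi ^ 2)) * t ^ 2) := by
        refine intervalIntegral.integral_mono_on (by linarith)
          (Continuous.intervalIntegrable (by fun_prop) _ _)
          (Continuous.intervalIntegrable (by fun_prop) _ _) fun t ht => ?_
        have := Real.cos_le_one_sub_mul_cos_sq (abs_le.2 ht)
        rw [Real.exp_le_exp]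
        nlinarith
    _ ≤ _ := by
        rw [intervalIntegral.integral_of_le (by linarith)]
        exact MeasureTheory.setIntegral_le_integral (integrable_exp_neg_mul_sq hb')
          (Filter.Eventually.of_forall fun t => (Real.exp_pos _).le)

variable {α : Type*} [Fintype α] {w : α → ℝ}

/-- The characteristic function of an integer-valued variable. -/
noncomputable def charFn (w : α → ℝ) (X : α → ℤ) (t : ℝ) : ℂ :=
  ∑ a, (w a : ℂ) * Complex.exp (X a * Complex.I * t)

theorem continuous_charFn (w : α → ℝ) (X : α → ℤ) : Continuous (charFn w X) := by
  unfold charFn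
  fun_prop

theorem charFn_pow_integral (w : α → ℝ) (X : α → ℤ) (n : ℕ) :
    ∫ t in (-Real.pi)..Real.pi, charFn w X t ^ n =
      2 * Real.pi * (iidPr w n (fun P => ∑ j, X (P j) = 0) : ℝ) := by
  have h : ∀ t : ℝ, charFn w X t ^ n = ∑ P : Fin n → α,
      ((∏ j, w (P j) : ℝ) : ℂ) * Complex.exp ((∑ j, X (P j) : ℤ) * Complex.I * t) := fun t => by
    rw [charFn, Fintype.sum_pow]
    refine Finset.sum_congr rfl fun P _ => ?_
    push_cast
    rw [Finset.prod_mul_distrib, ← Complex.exp_sum, Finset.sum_mul, Finset.sum_mul]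
  simp_rw [h]
  rw [intervalIntegral.integral_finsetSum
    fun P _ => Continuous.intervalIntegrable (by fun_prop) _ _]
  simp_rw [intervalIntegral.integral_const_mul, integral_exp_int_mul_I]
  simp only [iidPr, Complex.ofReal_sum, Finset.mul_sum]
  refine Finset.sum_congr rfl fun P _ => ?_
  split_ifs <;> simp [mul_comm]

theorem norm_charFn_le (hw : ∀ a, 0 ≤ w a) (hw1 : ∑ a, w a = 1) (X : α → ℤ) (a b : α)
    (t : ℝ) : ‖charFn w X t‖ ≤
      Real.exp (-(w a * w b / 2 * (1 - Real.cos (((X a - X b : ℤ) : ℝ) * t)))) := by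
  have hre : (charFn w X t).re = ∑ x, w x * Real.cos (X x * t) := by
    rw [charFn, Complex.re_sum]
    refine Finset.sum_congr rfl fun x _ => ?_
    rw [Complex.re_ofReal_mul,
      show (X x : ℂ) * Complex.I * t = ((X x * t : ℝ) : ℂ) * Complex.I by push_cast; ring,
      Complex.exp_ofReal_mul_I_re]
  have him : (charFn w X t).im = ∑ x, w x * Real.sin (X x * t) := by
    rw [charFn, Complex.im_sum]
    refine Finset.sum_congr rfl fun x _ => ?_
    rw [Complex.im_ofReal_mul,
      show (X x : ℂ) * Complex.I * t = ((X x * t : ℝ) : ℂ) * Complex.I by push_cast; ring,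
      Complex.exp_ofReal_mul_I_im]
  have hsq : 1 - ‖charFn w X t‖ ^ 2 =
      ∑ x, ∑ y, w x * w y * (1 - Real.cos (X x * t - X y * t)) := by
    rw [Complex.sq_norm, Complex.normSq_apply, hre, him, Finset.sum_mul_sum, Finset.sum_mul_sum]
    have : (1 : ℝ) = ∑ x, ∑ y, w x * w y := by
      rw [← Finset.sum_mul_sum, hw1, one_mul]
    conv_lhs => rw [this]
    simp only [← Finset.sum_add_distrib, ← Finset.sum_sub_distrib]
    refine Finset.sum_congr rfl fun x _ => Finset.sum_congr rfl fun y _ => ?_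
    rw [Real.cos_sub]
    ring
  have hnn : ∀ x y, 0 ≤ w x * w y * (1 - Real.cos (X x * t - X y * t)) := fun x y =>
    mul_nonneg (mul_nonneg (hw x) (hw y)) (by linarith [Real.cos_le_one (X x * t - X y * t)])
  have hle : w a * w b * (1 - Real.cos (X a * t - X b * t)) ≤ 1 - ‖charFn w X t‖ ^ 2 := by
    rw [hsq]
    exact (Finset.single_le_sum (f := fun y => w a * w y * (1 - Real.cos (X a * t - X y * t)))
      (fun y _ => hnn a y) (Finset.mem_univ b)).trans
      (Finset.single_le_sum
        (f := fun x => ∑ y, w x * w y * (1 - Real.cos (X x * t - X y * t)))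
        (fun x _ => Finset.sum_nonneg fun y _ => hnn x y) (Finset.mem_univ a))
  refine le_of_sq_le_sq ?_ (Real.exp_pos _).le
  rw [← Real.exp_nat_mul]
  push_cast
  rw [sub_mul]
  set q := w a * w b * (1 - Real.cos (X a * t - X b * t)) with hq
  calc _ ≤ -q + 1 := by linarith
    _ ≤ Real.exp (-q) := Real.add_one_le_exp _
    _ = _ := by rw [hq]; congr 1; ring

/-- A sum of `n` i.i.d. copies of a nonconstant integer variable vanishes with probability
`O(1 / √n)`. -/
theorem exists_iidPr_sum_eq_zero_le (hw : ∀ a, 0 < w a) (hw1 : ∑ a, w a = 1) (X : α → ℤ)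
    {a b : α} (hX : X a ≠ X b) :
    ∃ C : ℝ, 0 < C ∧ ∀ n : ℕ, 1 ≤ n → iidPr w n (fun P => ∑ j, X (P j) = 0) ≤ C / √n := by
  have hpi := Real.pi_pos
  have hq : 0 < w a * w b / 2 := by have := hw a; have := hw b; positivity
  set q := w a * w b / 2 with hqd
  refine ⟨√(Real.pi / (q * (2 / Real.pi ^ 2))) / (2 * Real.pi), by positivity, fun n hn => ?_⟩
  have hn0 : (0 : ℝ) < n := by exact_mod_cast hn
  have hd : X a - X b ≠ 0 := sub_ne_zero.2 hX
  have h1 : 2 * Real.pi * iidPr w n (fun P => ∑ j, X (P j) = 0) ≤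
      ∫ t in (-Real.pi)..Real.pi, ‖charFn w X t‖ ^ n := by
    calc _ ≤ ‖((2 * Real.pi * iidPr w n (fun P => ∑ j, X (P j) = 0) : ℝ) : ℂ)‖ := by
          rw [Complex.norm_real]; exact le_abs_self _
      _ = ‖∫ t in (-Real.pi)..Real.pi, charFn w X t ^ n‖ := by
          rw [charFn_pow_integral]; push_cast; rfl
      _ ≤ ∫ t in (-Real.pi)..Real.pi, ‖charFn w X t ^ n‖ :=
          intervalIntegral.norm_integral_le_integral_norm (by linarith)
      _ = _ := by simp_rw [norm_pow]
  have h2 : ∫ t in (-Real.pi)..Real.pi, ‖charFn w X t‖ ^ n ≤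
      ∫ t in (-Real.pi)..Real.pi,
        Real.exp (-(n * q * (1 - Real.cos (((X a - X b : ℤ) : ℝ) * t)))) := by
    refine intervalIntegral.integral_mono_on (by linarith)
      (Continuous.intervalIntegrable ((continuous_charFn w X).norm.pow n) _ _)
      (Continuous.intervalIntegrable (by fun_prop) _ _) fun t _ => ?_
    refine (pow_le_pow_left₀ (norm_nonneg _)
      (norm_charFn_le (fun a => (hw a).le) hw1 X a b t) n).trans_eq ?_
    rw [← Real.exp_nat_mul]
    congr 1
    ring
  rw [integral_comp_int_mul_of_periodic
    (g := fun t => Real.exp (-(n * q * (1 - Real.cos t)))) (by fun_prop)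
    (fun t => by simp only [Real.cos_add_two_pi]) hd] at h2
  have h3 := integral_exp_neg_mul_one_sub_cos_le (b := n * q) (by positivity)
  have h4 : √(Real.pi / (n * q * (2 / Real.pi ^ 2))) =
      √(Real.pi / (q * (2 / Real.pi ^ 2))) / √n := by
    rw [← Real.sqrt_div (by positivity)]
    congr 1
    field_simp
  rw [h4] at h3
  rw [div_right_comm, le_div_iff₀ (by positivity), mul_comm]
  linarith

end Concentration

section Collision

variable {α : Type*} [Fintype α] {w : α → ℝ}

theorem sq_iidPr_le_mul_iidPr_add_self (hw : ∀ a, 0 ≤ w a) (σ : α ≃ α)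
    (hσw : ∀ a, w (σ a) = w a) (X : α → ℤ) (hσX : ∀ a, X (σ a) = -X a) {l : ℕ}
    (G : (Fin l → α) → Prop) (hσG : ∀ P, G P → G (fun j => σ (P j)))
    (H : (Fin (l + l) → α) → Prop)
    (hH : ∀ P Q, G P → G Q → ∑ j, X (P j) + ∑ j, X (Q j) = 0 → H (Fin.append P Q)) (L : ℕ) :
    iidPr w l (fun P => G P ∧ |∑ j, X (P j)| ≤ L) ^ 2 ≤ (2 * L + 1) * iidPr w (l + l) H := by
  classical
  have hprod : ∀ P : Fin l → α, 0 ≤ ∏ j, w (P j) := fun P =>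
    Finset.prod_nonneg fun j _ => hw (P j)
  have key := sq_sum_le_mul_sum_cancel (fun P : Fin l → α => ∏ j, w (P j)) hprod
    (fun P => ∑ j, X (P j)) G (Equiv.piCongrRight fun _ => σ) (fun P => by simp [hσw])
    (fun P => by simp [hσX]) (fun P hP => hσG P hP) L
  have h1 : iidPr w l (fun P => G P ∧ |∑ j, X (P j)| ≤ L) =
      ∑ P : Fin l → α, if G P ∧ |∑ j, X (P j)| ≤ L then ∏ j, w (P j) else 0 :=
    Finset.sum_congr rfl fun P _ => by congr
  rw [h1]
  refine key.trans (mul_le_mul_of_nonneg_left ?_ (by positivity))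
  rw [iidPr, ← (Fin.appendEquiv l l).sum_comp, Fintype.sum_prod_type]
  refine Finset.sum_le_sum fun P _ => Finset.sum_le_sum fun Q _ => ?_
  have h0 := mul_nonneg (hprod P) (hprod Q)
  have h2 : ∏ j, w (Fin.appendEquiv l l (P, Q) j) = (∏ j, w (P j)) * ∏ j, w (Q j) := by
    rw [Fin.prod_univ_add]
    simp only [Fin.appendEquiv, Equiv.coe_fn_mk, Fin.append_left, Fin.append_right]
  rw [h2]
  by_cases h : G P ∧ G Q ∧ ∑ j, X (P j) + ∑ j, X (Q j) = 0
  · have : H (Fin.appendEquiv l l (P, Q)) := hH P Q h.1 h.2.1 h.2.2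
    simp [h, this]
  · rw [if_neg h]
    split_ifs <;> simp [h0]

theorem exists_div_sqrt_le_iidPr_add_self (hw : ∀ a, 0 ≤ w a) (hw1 : ∑ a, w a = 1) {B c : ℝ}
    (hB : 0 ≤ B) (hc : 0 < c) : ∃ c' : ℝ, 0 < c' ∧ ∀ (σ : α ≃ α), (∀ a, w (σ a) = w a) →
    ∀ X : α → ℤ, (∀ a, X (σ a) = -X a) → ∑ a, w a * (X a : ℝ) ^ 2 ≤ B →
    ∀ l : ℕ, 1 ≤ l → ∀ G : (Fin l → α) → Prop, (∀ P, G P → G (fun j => σ (P j))) →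
    c ≤ iidPr w l G → ∀ H : (Fin (l + l) → α) → Prop,
    (∀ P Q, G P → G Q → ∑ j, X (P j) + ∑ j, X (Q j) = 0 → H (Fin.append P Q)) →
    c' / √l ≤ iidPr w (l + l) H := by
  set K := √(2 * (B + 1) / c) with hK
  have hK0 : 0 < K := by positivity
  have hK2 : K ^ 2 = 2 * (B + 1) / c := Real.sq_sqrt (by positivity)
  refine ⟨(c / 2) ^ 2 / (2 * K + 3), by positivity, ?_⟩
  intro σ hσw X hσX hXB l hl G hσG hcG H hH
  have hl1 : (1 : ℝ) ≤ l := by exact_mod_cast hl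
  have hsl : 1 ≤ √(l : ℝ) := Real.one_le_sqrt.2 hl1
  set L := ⌈K * √(l : ℝ)⌉₊ with hL
  have hL1 : K * √(l : ℝ) ≤ L := Nat.le_ceil _
  have hL2 : (L : ℝ) < K * √(l : ℝ) + 1 := Nat.ceil_lt_add_one (by positivity)
  have hLpos : (0 : ℝ) < L := lt_of_lt_of_le (by positivity) hL1
  have hmean : ∑ a, w a * (X a : ℝ) = 0 := by
    have : ∑ a, w a * (X a : ℝ) = -∑ a, w a * (X a : ℝ) := by
      conv_lhs => rw [← σ.sum_comp]
      simp [hσw, hσX]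
    linarith
  have hcheb := iidPr_lt_sq_sum_le hw hw1 (fun a => (X a : ℝ)) hmean l
    (t := (L : ℝ) ^ 2) (by positivity)
  have hcheb' : (l : ℝ) * (∑ a, w a * (X a : ℝ) ^ 2) / (L : ℝ) ^ 2 ≤ c / 2 := by
    rw [div_le_iff₀ (by positivity)]
    have h1 : K ^ 2 * l ≤ (L : ℝ) ^ 2 := by
      calc K ^ 2 * l = (K * √(l : ℝ)) ^ 2 := by rw [mul_pow, Real.sq_sqrt (Nat.cast_nonneg l)]
        _ ≤ _ := by gcongr
    rw [hK2] at h1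
    calc _ ≤ (l : ℝ) * (B + 1) := by gcongr; linarith
      _ = c / 2 * (2 * (B + 1) / c * l) := by field_simp
      _ ≤ _ := by gcongr
  have hsplit : iidPr w l G ≤ iidPr w l (fun P => G P ∧ |∑ j, X (P j)| ≤ L) +
      iidPr w l (fun P => (L : ℝ) ^ 2 < (∑ j, (X (P j) : ℝ)) ^ 2) := by
    refine (iidPr_mono hw fun P hP => ?_).trans (iidPr_or_le hw _ _)
    by_cases h : |∑ j, X (P j)| ≤ L
    · exact Or.inl ⟨hP, h⟩
    · refine Or.inr ?_
      rw [sq_lt_sq, abs_of_pos hLpos]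
      exact_mod_cast not_le.1 h
  have hkey := sq_iidPr_le_mul_iidPr_add_self hw σ hσw X hσX G hσG H hH L
  have hhalf : c / 2 ≤ iidPr w l (fun P => G P ∧ |∑ j, X (P j)| ≤ L) := by linarith
  have hnn := iidPr_nonneg hw H
  have : (c / 2) ^ 2 ≤ (2 * K + 3) * √(l : ℝ) * iidPr w (l + l) H :=
    calc (c / 2) ^ 2 ≤ _ := pow_le_pow_left₀ (by positivity) hhalf 2
      _ ≤ _ := hkey
      _ ≤ _ := by gcongr; nlinarith
  rw [div_div, div_le_iff₀ (by positivity)]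
  linarith

theorem mul_iidPr_le_iidPr_succ (hw : ∀ a, 0 ≤ w a) (a : α) {n : ℕ} (E : (Fin n → α) → Prop)
    (F : (Fin (n + 1) → α) → Prop) (h : ∀ P, E P → F (Fin.cons a P)) :
    w a * iidPr w n E ≤ iidPr w (n + 1) F := by
  classical
  rw [iidPr, iidPr, ← (Fin.consEquiv fun _ => α).sum_comp, Fintype.sum_prod_type, Finset.mul_sum]
  have hnn : ∀ (b : α) (P : Fin n → α), (0 : ℝ) ≤ if F (Fin.cons b P) then
      ∏ j, w ((Fin.cons b P : Fin (n + 1) → α) j) else 0 := fun b P => by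
    have := Finset.prod_nonneg fun j (_ : j ∈ Finset.univ) =>
      hw ((Fin.cons b P : Fin (n + 1) → α) j)
    split_ifs <;> simp [this]
  refine le_trans (Finset.sum_le_sum fun P _ => ?_) (Finset.single_le_sum
    (f := fun b => ∑ P : Fin n → α, if F (Fin.cons b P) then
      ∏ j, w ((Fin.cons b P : Fin (n + 1) → α) j) else 0)
    (fun b _ => Finset.sum_nonneg fun P _ => hnn b P) (Finset.mem_univ a))
  by_cases hE : E P
  · simp [hE, h P hE, Fin.prod_univ_succ]
  · rw [if_neg hE, mul_zero]
    exact hnn a P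

end Collision

section Ballots

variable {m k : ℕ} {p : Fin m → ℝ} {s : ℕ → ℤ}

theorem iadProb_pos (hp : ∀ i, 0 < p i ∧ p i < 1) (A : Finset (Fin m)) : 0 < iadProb m p A :=
  mul_pos (Finset.prod_pos fun i _ => (hp i).1)
    (Finset.prod_pos fun i _ => sub_pos.2 (hp i).2)

theorem sum_iadProb (p : Fin m → ℝ) : ∑ A, iadProb m p A = 1 := by
  have := Finset.prod_add p (fun i => 1 - p i) Finset.univ
  simpa [iadProb, Finset.compl_eq_univ_sdiff] using this.symm

theorem iadProb_eq_odds (hp : ∀ i, 0 < p i ∧ p i < 1) (A : Finset (Fin m)) :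
    iadProb m p A = (∏ i, (1 - p i)) * ∏ i ∈ A, p i / (1 - p i) := by
  have h : ∏ i ∈ A, p i = (∏ i ∈ A, (1 - p i)) * ∏ i ∈ A, p i / (1 - p i) := by
    rw [← Finset.prod_mul_distrib]
    exact Finset.prod_congr rfl fun i _ =>
      (mul_div_cancel₀ _ (sub_pos.2 (hp i).2).ne').symm
  rw [iadProb, h, ← Finset.prod_mul_prod_compl A (fun i => 1 - p i)]
  ring

theorem iadProb_finsetCongr (hp : ∀ i, 0 < p i ∧ p i < 1) {σ : Equiv.Perm (Fin m)}
    (hσ : ∀ i, p (σ i) = p i) (A : Finset (Fin m)) :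
    iadProb m p (σ.finsetCongr A) = iadProb m p A := by
  simp [iadProb_eq_odds hp, Equiv.finsetCongr_apply, hσ]

theorem card_finsetCongr_inter (σ : Equiv.Perm (Fin m)) (A U : Finset (Fin m)) :
    (σ.finsetCongr A ∩ σ.finsetCongr U).card = (A ∩ U).card := by
  rw [Equiv.finsetCongr_apply, Equiv.finsetCongr_apply, ← Finset.map_inter, Finset.card_map]

theorem iadProb_insert_lt_insert (hp : ∀ i, 0 < p i ∧ p i < 1) {i j : Fin m} (hij : p i < p j)
    {B : Finset (Fin m)} (hi : i ∉ B) (hj : j ∉ B) :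
    iadProb m p (insert i B) < iadProb m p (insert j B) := by
  have hq : ∀ x, 0 < 1 - p x := fun x => sub_pos.2 (hp x).2
  rw [iadProb_eq_odds hp, iadProb_eq_odds hp, Finset.prod_insert hi, Finset.prod_insert hj]
  have h1 : 0 < ∏ x, (1 - p x) := Finset.prod_pos fun x _ => hq x
  have h2 : 0 < ∏ x ∈ B, p x / (1 - p x) := Finset.prod_pos fun x _ => div_pos (hp x).1 (hq x)
  have h3 : p i / (1 - p i) < p j / (1 - p j) := by
    rw [div_lt_div_iff₀ (hq i) (hq j)]
    nlinarith
  gcongr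

/-- The expected score that a random ballot gives to the committee `W`. -/
noncomputable def meanScore (p : Fin m → ℝ) (s : ℕ → ℤ) (W : Finset (Fin m)) : ℝ :=
  ∑ A, iadProb m p A * (s (A ∩ W).card : ℝ)

theorem meanScore_finsetCongr (hp : ∀ i, 0 < p i ∧ p i < 1) {σ : Equiv.Perm (Fin m)}
    (hσ : ∀ i, p (σ i) = p i) (W : Finset (Fin m)) :
    meanScore p s (σ.finsetCongr W) = meanScore p s W := by
  rw [meanScore, ← σ.finsetCongr.sum_comp]
  exact Finset.sum_congr rfl fun A _ => by rw [iadProb_finsetCongr hp hσ, card_finsetCongr_inter]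

theorem card_inter_insert {A U : Finset (Fin m)} {i : Fin m} (hi : i ∉ U) :
    (A ∩ insert i U).card = (A ∩ U).card + if i ∈ A then 1 else 0 := by
  split_ifs with h
  · rw [Finset.inter_insert_of_mem h, Finset.card_insert_of_notMem (by simp [hi])]
  · rw [Finset.inter_insert_of_notMem h, add_zero]

theorem finsetCongr_swap_insert {i j : Fin m} {B : Finset (Fin m)} (hi : i ∉ B) (hj : j ∉ B) :
    (Equiv.swap i j).finsetCongr (insert i B) = insert j B := by
  ext x
  rw [Equiv.finsetCongr_apply, Finset.mem_map_equiv, Equiv.symm_swap, Finset.mem_insert,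
    Finset.mem_insert]
  by_cases hxi : x = i
  · subst hxi
    by_cases hxj : x = j
    · simp [hxj]
    · simp [hi, hj, hxj, Ne.symm hxj]
  · by_cases hxj : x = j
    · subst hxj; simp
    · simp [Equiv.swap_apply_of_ne_of_ne hxi hxj, hxi, hxj]

/-- Exchanging a member for a strictly more popular candidate raises the expected score. -/
theorem meanScore_insert_lt_insert (hp : ∀ i, 0 < p i ∧ p i < 1)
    (hmono : ∀ i < k, s i ≤ s (i + 1)) (hnc : ∃ i < k, s i ≠ s (i + 1))
    {i j : Fin m} (hij : p i < p j) {U : Finset (Fin m)} (hi : i ∉ U) (hj : j ∉ U)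
    (hU : U.card + 1 = k) :
    meanScore p s (insert i U) < meanScore p s (insert j U) := by
  have hne : i ≠ j := fun h => by subst h; exact lt_irrefl _ hij
  set τ := (Equiv.swap i j).finsetCongr with hτ
  set g : Finset (Fin m) → ℝ := fun A =>
    (s (A ∩ insert j U).card : ℝ) - s (A ∩ insert i U).card with hg
  have hτi : τ (insert i U) = insert j U := finsetCongr_swap_insert hi hj
  have hτj : τ (insert j U) = insert i U := by
    rw [hτ, Equiv.swap_comm]
    exact finsetCongr_swap_insert hj hi
  have hgτ : ∀ A, g (τ A) = -g A := fun A => by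
    have h1 : (τ A ∩ insert j U).card = (A ∩ insert i U).card := by
      rw [← hτi]; exact card_finsetCongr_inter _ _ _
    have h2 : (τ A ∩ insert i U).card = (A ∩ insert j U).card := by
      rw [← hτj]; exact card_finsetCongr_inter _ _ _
    simp only [hg, h1, h2]
    ring
  have hd : meanScore p s (insert j U) - meanScore p s (insert i U) = ∑ A, iadProb m p A * g A := by
    rw [meanScore, meanScore, ← Finset.sum_sub_distrib]
    exact Finset.sum_congr rfl fun A _ => by simp only [hg]; ring
  have hd' : ∑ A, iadProb m p A * g A = -∑ A, iadProb m p (τ A) * g A := by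
    conv_lhs => rw [← τ.sum_comp]
    rw [← Finset.sum_neg_distrib]
    exact Finset.sum_congr rfl fun A _ => by rw [hgτ]; ring
  have h2d : 2 * (meanScore p s (insert j U) - meanScore p s (insert i U)) =
      ∑ A, (iadProb m p A - iadProb m p (τ A)) * g A := by
    rw [two_mul]
    nth_rewrite 2 [hd]
    rw [hd, hd', ← sub_eq_neg_add, ← hd', ← Finset.sum_sub_distrib]
    exact Finset.sum_congr rfl fun A _ => by ring
  have hstep : ∀ A : Finset (Fin m), (s (A ∩ U).card : ℝ) ≤ s ((A ∩ U).card + 1) := fun A => by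
    have : (A ∩ U).card ≤ U.card := Finset.card_le_card Finset.inter_subset_right
    exact_mod_cast hmono _ (by omega)
  have hj_case : ∀ A, j ∈ A → i ∉ A → iadProb m p (τ A) < iadProb m p A ∧
      g A = s ((A ∩ U).card + 1) - s (A ∩ U).card := fun A hjA hiA => by
    constructor
    · rw [← Finset.insert_erase hjA, hτ, Equiv.swap_comm,
        finsetCongr_swap_insert (by simp) (by simp [hiA])]
      exact iadProb_insert_lt_insert hp hij (by simp [hiA]) (by simp)
    · simp [hg, card_inter_insert hi, card_inter_insert hj, hjA, hiA]
  have hi_case : ∀ A, i ∈ A → j ∉ A → iadProb m p A < iadProb m p (τ A) ∧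
      g A = s (A ∩ U).card - s ((A ∩ U).card + 1) := fun A hiA hjA => by
    constructor
    · rw [← Finset.insert_erase hiA, hτ,
        finsetCongr_swap_insert (by simp) (by simp [hjA])]
      exact iadProb_insert_lt_insert hp hij (by simp) (by simp [hjA])
    · simp [hg, card_inter_insert hi, card_inter_insert hj, hjA, hiA]
  have hnn : ∀ A, 0 ≤ (iadProb m p A - iadProb m p (τ A)) * g A := fun A => by
    by_cases hjA : j ∈ A <;> by_cases hiA : i ∈ A
    · simp [hg, card_inter_insert hi, card_inter_insert hj, hjA, hiA]
    · obtain ⟨h1, h2⟩ := hj_case A hjA hiA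
      exact mul_nonneg (sub_nonneg.2 h1.le) (by rw [h2]; exact sub_nonneg.2 (hstep A))
    · obtain ⟨h1, h2⟩ := hi_case A hiA hjA
      exact mul_nonneg_of_nonpos_of_nonpos (sub_nonpos.2 h1.le)
        (by rw [h2]; exact sub_nonpos.2 (hstep A))
    · simp [hg, card_inter_insert hi, card_inter_insert hj, hjA, hiA]
  have hpos : 0 < ∑ A, (iadProb m p A - iadProb m p (τ A)) * g A := by
    obtain ⟨t, htk, ht⟩ := hnc
    obtain ⟨T, hTU, hT⟩ := Finset.exists_subset_card_eq (s := U) (n := t) (by omega)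
    refine Finset.sum_pos' (fun A _ => hnn A) ⟨insert j T, Finset.mem_univ _, ?_⟩
    obtain ⟨h1, h2⟩ := hj_case (insert j T) (by simp)
      fun h => (Finset.mem_insert.1 h).elim hne fun h => hi (hTU h)
    have hcard : (insert j T ∩ U).card = t := by
      rw [Finset.insert_inter_of_notMem hj, Finset.inter_eq_left.2 hTU, hT]
    rw [hcard] at h2
    refine mul_pos (sub_pos.2 h1) ?_
    rw [h2, sub_pos]
    exact_mod_cast lt_of_le_of_ne (hmono t htk) ht
  linarith

theorem mem_topk {W : Finset (Fin m)} :
    W ∈ topk m k p ↔ W.card = k ∧ ∀ i ∈ W, ∀ j : Fin m, j ∉ W → p j ≤ p i := by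
  simp [topk]

theorem exists_meanScore_lt (hp : ∀ i, 0 < p i ∧ p i < 1)
    (hmono : ∀ i < k, s i ≤ s (i + 1)) (hnc : ∃ i < k, s i ≠ s (i + 1))
    {U : Finset (Fin m)} (hU : U.card = k) (hUt : U ∉ topk m k p) :
    ∃ V : Finset (Fin m), V.card = k ∧ meanScore p s U < meanScore p s V := by
  simp only [mem_topk, hU, true_and, not_forall, not_le] at hUt
  obtain ⟨i, hi, j, hj, hij⟩ := hUt
  have hcard : (U.erase i).card + 1 = k := by rw [Finset.card_erase_add_one hi, hU]
  have hj' : j ∉ U.erase i := fun h => hj (Finset.mem_of_mem_erase h)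
  refine ⟨insert j (U.erase i), by rw [Finset.card_insert_of_notMem hj', hcard], ?_⟩
  have := meanScore_insert_lt_insert hp hmono hnc hij (Finset.notMem_erase i U) hj' hcard
  rwa [Finset.insert_erase hi] at this

/-- Two sets of equal size are exchanged by an involution that only moves points of their
symmetric difference, swapping the two sides. -/
theorem exists_perm_exchange {W V : Finset (Fin m)} (h : W.card = V.card) :
    ∃ σ : Equiv.Perm (Fin m), σ.finsetCongr W = V ∧ σ.finsetCongr V = W ∧
      ∀ i, σ i = i ∨ (i ∈ W \ V ∧ σ i ∈ V \ W) ∨ (i ∈ V \ W ∧ σ i ∈ W \ V) := by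
  have hc : (W \ V).card = (V \ W).card := Finset.card_sdiff_comm h
  let e : ↥(W \ V) ≃ ↥(V \ W) := Finset.equivOfCardEq hc
  let g : Fin m → Fin m := fun x =>
    if hx : x ∈ W \ V then e ⟨x, hx⟩ else if hx : x ∈ V \ W then e.symm ⟨x, hx⟩ else x
  have hg1 : ∀ x (hx : x ∈ W \ V), g x = e ⟨x, hx⟩ := fun x hx => by simp only [g, dif_pos hx]
  have hn : ∀ x, x ∈ V \ W → x ∉ W \ V := fun x hx h' => by
    rw [Finset.mem_sdiff] at hx h'; exact hx.2 h'.1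
  have hg2 : ∀ x (hx : x ∈ V \ W), g x = e.symm ⟨x, hx⟩ := fun x hx => by
    simp only [g, dif_neg (hn x hx), dif_pos hx]
  have hg3 : ∀ x, x ∉ W \ V → x ∉ V \ W → g x = x := fun x hx hx' => by
    simp only [g, dif_neg hx, dif_neg hx']
  have hinv : Function.Involutive g := fun x => by
    by_cases hx : x ∈ W \ V
    · rw [hg1 x hx, hg2 _ (e ⟨x, hx⟩).2]; simp
    · by_cases hx' : x ∈ V \ W
      · rw [hg2 x hx', hg1 _ (e.symm ⟨x, hx'⟩).2]; simp
      · rw [hg3 x hx hx', hg3 x hx hx']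
  have hWV : ∀ x ∈ W, g x ∈ V := fun x hx => by
    by_cases hxV : x ∈ V
    · rw [hg3 x (by simp [hxV]) (by simp [hx])]; exact hxV
    · rw [hg1 x (by simp [hx, hxV])]; exact (Finset.mem_sdiff.1 (e _).2).1
  have hVW : ∀ x ∈ V, g x ∈ W := fun x hx => by
    by_cases hxW : x ∈ W
    · rw [hg3 x (by simp [hx]) (by simp [hxW])]; exact hxW
    · rw [hg2 x (by simp [hx, hxW])]; exact (Finset.mem_sdiff.1 (e.symm _).2).1
  refine ⟨hinv.toPerm g, ?_, ?_, fun x => ?_⟩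
  · refine Finset.eq_of_subset_of_card_le (fun y hy => ?_) (by simp [Equiv.finsetCongr_apply, h])
    rw [Equiv.finsetCongr_apply, Finset.mem_map] at hy
    obtain ⟨x, hx, rfl⟩ := hy
    exact hWV x hx
  · refine Finset.eq_of_subset_of_card_le (fun y hy => ?_) (by simp [Equiv.finsetCongr_apply, h])
    rw [Equiv.finsetCongr_apply, Finset.mem_map] at hy
    obtain ⟨x, hx, rfl⟩ := hy
    exact hVW x hx
  · change g x = x ∨ (_ ∧ g x ∈ _) ∨ (_ ∧ g x ∈ _)
    by_cases hx : x ∈ W \ V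
    · exact Or.inr (Or.inl ⟨hx, by rw [hg1 x hx]; exact (e _).2⟩)
    · by_cases hx' : x ∈ V \ W
      · exact Or.inr (Or.inr ⟨hx', by rw [hg2 x hx']; exact (e.symm _).2⟩)
      · exact Or.inl (hg3 x hx hx')

theorem exists_perm_of_mem_topk {W V : Finset (Fin m)} (hW : W ∈ topk m k p)
    (hV : V ∈ topk m k p) : ∃ σ : Equiv.Perm (Fin m), σ.finsetCongr W = V ∧
      σ.finsetCongr V = W ∧ ∀ i, p (σ i) = p i := by
  rw [mem_topk] at hW hV
  have heq : ∀ x ∈ W \ V, ∀ y ∈ V \ W, p x = p y := fun x hx y hy => by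
    rw [Finset.mem_sdiff] at hx hy
    exact le_antisymm (hV.2 y hy.1 x hx.2) (hW.2 x hx.1 y hy.2)
  obtain ⟨σ, h1, h2, h3⟩ := exists_perm_exchange (hW.1.trans hV.1.symm)
  refine ⟨σ, h1, h2, fun i => ?_⟩
  obtain h | ⟨h, h'⟩ | ⟨h, h'⟩ := h3 i
  · rw [h]
  · exact (heq _ h _ h').symm
  · exact heq _ h' _ h

theorem meanScore_lt_of_mem_topk (hp : ∀ i, 0 < p i ∧ p i < 1)
    (hmono : ∀ i < k, s i ≤ s (i + 1)) (hnc : ∃ i < k, s i ≠ s (i + 1))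
    {W U : Finset (Fin m)} (hW : W ∈ topk m k p) (hU : U.card = k) (hUt : U ∉ topk m k p) :
    meanScore p s U < meanScore p s W := by
  obtain ⟨M, hM, hmax⟩ := Finset.exists_max_image
    (Finset.univ.filter fun V : Finset (Fin m) => V.card = k) (meanScore p s) ⟨U, by simp [hU]⟩
  simp only [Finset.mem_filter, Finset.mem_univ, true_and] at hM hmax
  have hMt : M ∈ topk m k p := by
    by_contra h
    obtain ⟨V, hV, hlt⟩ := exists_meanScore_lt hp hmono hnc hM h
    exact absurd (hmax V hV) (not_le.2 hlt)
  obtain ⟨σ, hσ, -, hσp⟩ := exists_perm_of_mem_topk hW hMt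
  obtain ⟨V, hV, hlt⟩ := exists_meanScore_lt hp hmono hnc hU hUt
  calc _ < _ := hlt
    _ ≤ _ := hmax V hV
    _ = _ := by rw [← hσ, meanScore_finsetCongr hp hσp]

/-- Any two distinct committees of the same size are separated by one unit of representation on
some ballot, at any prescribed level. -/
theorem exists_card_inter_eq {W V : Finset (Fin m)} (hW : W.card = k) (hV : V.card = k)
    (hne : W ≠ V) {t : ℕ} (ht : t < k) :
    ∃ A : Finset (Fin m), (A ∩ W).card = t + 1 ∧ (A ∩ V).card = t := by
  have h1 := Finset.card_inter_add_card_sdiff W V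
  have h2 := Finset.card_inter_add_card_sdiff V W
  rw [Finset.inter_comm V W] at h2
  have h3 : (W \ V).card ≠ 0 := fun h => hne <|
    Finset.eq_of_subset_of_card_le (Finset.sdiff_eq_empty_iff_subset.1 (Finset.card_eq_zero.1 h))
      (by omega)
  set c := min t (W ∩ V).card with hc
  obtain ⟨C, hCs, hCc⟩ := Finset.exists_subset_card_eq (s := W ∩ V) (n := c) (by omega)
  obtain ⟨D, hDs, hDc⟩ := Finset.exists_subset_card_eq (s := W \ V) (n := t + 1 - c) (by omega)
  obtain ⟨E, hEs, hEc⟩ := Finset.exists_subset_card_eq (s := V \ W) (n := t - c) (by omega)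
  have hCs' := fun x (hx : x ∈ C) => Finset.mem_inter.1 (hCs hx)
  have hDs' := fun x (hx : x ∈ D) => Finset.mem_sdiff.1 (hDs hx)
  have hEs' := fun x (hx : x ∈ E) => Finset.mem_sdiff.1 (hEs hx)
  refine ⟨C ∪ D ∪ E, ?_, ?_⟩
  · have : (C ∪ D ∪ E) ∩ W = C ∪ D := by ext x; grind
    rw [this, Finset.card_union_of_disjoint (Finset.disjoint_left.2 fun x hx hx' =>
      (hDs' x hx').2 (hCs' x hx).2)]
    omega
  · have : (C ∪ D ∪ E) ∩ V = C ∪ E := by ext x; grind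
    rw [this, Finset.card_union_of_disjoint (Finset.disjoint_left.2 fun x hx hx' =>
      (hEs' x hx').2 (hCs' x hx).1)]
    omega

end Ballots

section Profiles

variable {m k n l : ℕ} {p : Fin m → ℝ} {s : ℕ → ℤ}

theorem prIAD_eq_iidPr (p : Fin m → ℝ) (Ev : (Fin n → Finset (Fin m)) → Prop) :
    prIAD m n p Ev = iidPr (iadProb m p) n Ev := rfl

theorem mem_thieleWinnersZ {P : Fin n → Finset (Fin m)} {W : Finset (Fin m)} :
    W ∈ thieleWinnersZ m k s P ↔ W.card = k ∧
      ∀ W' : Finset (Fin m), W'.card = k → thieleScoreZ s P W' ≤ thieleScoreZ s P W := by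
  simp [thieleWinnersZ]

theorem two_le_card_thieleWinnersZ {P : Fin n → Finset (Fin m)} {W V : Finset (Fin m)}
    (hne : W ≠ V) (hW : W ∈ thieleWinnersZ m k s P) (hV : V ∈ thieleWinnersZ m k s P) :
    2 ≤ (thieleWinnersZ m k s P).card :=
  Finset.one_lt_card.2 ⟨W, hW, V, hV, hne⟩

theorem thieleScoreZ_append (P : Fin n → Finset (Fin m)) (Q : Fin l → Finset (Fin m))
    (W : Finset (Fin m)) :
    thieleScoreZ s (Fin.append P Q) W = thieleScoreZ s P W + thieleScoreZ s Q W := by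
  simp [thieleScoreZ, Fin.sum_univ_add]

theorem thieleWinnersZ_cons_empty (P : Fin n → Finset (Fin m)) :
    thieleWinnersZ m k s (Fin.cons ∅ P : Fin (n + 1) → Finset (Fin m)) =
      thieleWinnersZ m k s P := by
  ext W
  simp [mem_thieleWinnersZ, thieleScoreZ, Fin.sum_univ_succ]

theorem thieleScoreZ_finsetCongr (σ : Equiv.Perm (Fin m)) (P : Fin n → Finset (Fin m))
    (W : Finset (Fin m)) :
    thieleScoreZ s (fun j => σ.finsetCongr (P j)) (σ.finsetCongr W) = thieleScoreZ s P W :=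
  Finset.sum_congr rfl fun j _ => by rw [card_finsetCongr_inter]

theorem thieleScoreZ_sub (P : Fin n → Finset (Fin m)) (W V : Finset (Fin m)) :
    thieleScoreZ s P W - thieleScoreZ s P V =
      ∑ j, (s (P j ∩ W).card - s (P j ∩ V).card) := by
  rw [thieleScoreZ, thieleScoreZ, Finset.sum_sub_distrib]

/-- No other `k`-committee scores more than the average of `W` and `V`. -/
def AverageDominates (k : ℕ) (s : ℕ → ℤ) (W V : Finset (Fin m))
    (P : Fin n → Finset (Fin m)) : Prop :=
  ∀ U : Finset (Fin m), U.card = k → U ≠ W → U ≠ V →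
    2 * thieleScoreZ s P U ≤ thieleScoreZ s P W + thieleScoreZ s P V

theorem AverageDominates.finsetCongr {W V : Finset (Fin m)} {P : Fin n → Finset (Fin m)}
    (h : AverageDominates k s W V P) {σ : Equiv.Perm (Fin m)} (hW : σ.finsetCongr W = V)
    (hV : σ.finsetCongr V = W) :
    AverageDominates k s W V fun j => σ.finsetCongr (P j) := by
  intro U hU hUW hUV
  obtain ⟨U, rfl⟩ := σ.finsetCongr.surjective U
  have h1 := thieleScoreZ_finsetCongr (s := s) σ P W
  have h2 := thieleScoreZ_finsetCongr (s := s) σ P V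
  rw [hW] at h1
  rw [hV] at h2
  rw [h1, h2, thieleScoreZ_finsetCongr, add_comm]
  refine h U (by simpa [Equiv.finsetCongr_apply] using hU) ?_ ?_
  · rintro rfl; exact hUV hW
  · rintro rfl; exact hUW hV

theorem AverageDominates.two_le_card_append {W V : Finset (Fin m)} (hW : W.card = k)
    (hV : V.card = k) (hne : W ≠ V) {P : Fin n → Finset (Fin m)} {Q : Fin l → Finset (Fin m)}
    (hP : AverageDominates k s W V P) (hQ : AverageDominates k s W V Q)
    (h : ∑ j, (s (P j ∩ W).card - s (P j ∩ V).card) +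
      ∑ j, (s (Q j ∩ W).card - s (Q j ∩ V).card) = 0) :
    2 ≤ (thieleWinnersZ m k s (Fin.append P Q)).card := by
  rw [← thieleScoreZ_sub, ← thieleScoreZ_sub] at h
  have key : ∀ U : Finset (Fin m), U.card = k →
      thieleScoreZ s (Fin.append P Q) U ≤ thieleScoreZ s (Fin.append P Q) W ∧
      thieleScoreZ s (Fin.append P Q) U ≤ thieleScoreZ s (Fin.append P Q) V := fun U hU => by
    simp only [thieleScoreZ_append]
    by_cases hUW : U = W
    · subst hUW; constructor <;> linarith
    · by_cases hUV : U = V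
      · subst hUV; constructor <;> linarith
      · have := hP U hU hUW hUV
        have := hQ U hU hUW hUV
        constructor <;> linarith
  exact two_le_card_thieleWinnersZ hne (mem_thieleWinnersZ.2 ⟨hW, fun U hU => (key U hU).1⟩)
    (mem_thieleWinnersZ.2 ⟨hV, fun U hU => (key U hU).2⟩)

theorem exists_averageDominates (hT : 2 ≤ (topk m k p).card) {P : Fin n → Finset (Fin m)}
    (hP : ∀ W ∈ topk m k p, ∀ U : Finset (Fin m), U.card = k → U ∉ topk m k p →
      thieleScoreZ s P U ≤ thieleScoreZ s P W) :
    ∃ W ∈ topk m k p, ∃ V ∈ topk m k p, W ≠ V ∧ AverageDominates k s W V P := by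
  obtain ⟨W, hW, hWmax⟩ := Finset.exists_max_image (topk m k p) (thieleScoreZ s P)
    (Finset.card_pos.1 (by omega))
  obtain ⟨V, hV, hVmax⟩ := Finset.exists_max_image ((topk m k p).erase W) (thieleScoreZ s P)
    (Finset.card_pos.1 (by rw [Finset.card_erase_of_mem hW]; omega))
  rw [Finset.mem_erase] at hV
  refine ⟨W, hW, V, hV.2, hV.1.symm, fun U hU hUW hUV => ?_⟩
  by_cases hUt : U ∈ topk m k p
  · have h1 := hWmax U hUt
    have h2 := hVmax U (Finset.mem_erase.2 ⟨hUW, hUt⟩)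
    linarith
  · have h1 := hP W hW U hU hUt
    have h2 := hP V hV.2 U hU hUt
    linarith

variable (k p s) in
/-- The pairs of a top committee and a `k`-committee outside `topk`. -/
noncomputable def topPairs : Finset (Finset (Fin m) × Finset (Fin m)) :=
  topk m k p ×ˢ (Finset.univ.filter fun U => U.card = k ∧ U ∉ topk m k p)

theorem exists_iidPr_upset_le (hp : ∀ i, 0 < p i ∧ p i < 1)
    (hmono : ∀ i < k, s i ≤ s (i + 1)) (hnc : ∃ i < k, s i ≠ s (i + 1)) :
    ∃ r C : ℝ, 0 < r ∧ r < 1 ∧ 0 < C ∧ ∀ n : ℕ, iidPr (iadProb m p) n (fun P =>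
      ∃ W ∈ topk m k p, ∃ U : Finset (Fin m), U.card = k ∧ U ∉ topk m k p ∧
        thieleScoreZ s P W ≤ thieleScoreZ s P U) ≤ C * r ^ n := by
  have hw : ∀ A, 0 ≤ iadProb m p A := fun A => (iadProb_pos hp A).le
  have hpair : ∀ x : Finset (Fin m) × Finset (Fin m), ∃ r : ℝ, 0 < r ∧ r < 1 ∧
      (x ∈ topPairs k p → ∀ n, iidPr (iadProb m p) n
        (fun P => thieleScoreZ s P x.1 ≤ thieleScoreZ s P x.2) ≤ r ^ n) := fun x => by
    by_cases hx : x ∈ topPairs k p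
    · simp only [topPairs, Finset.mem_product, Finset.mem_filter, Finset.mem_univ,
        true_and] at hx
      have hlt := meanScore_lt_of_mem_topk hp hmono hnc hx.1 hx.2.1 hx.2.2
      obtain ⟨r, h0, h1, h⟩ := exists_iidPr_nonneg_sum_le_pow hw (sum_iadProb p)
        (fun A => (s (A ∩ x.2).card : ℝ) - s (A ∩ x.1).card) (by
          simp only [mul_sub, Finset.sum_sub_distrib]
          exact sub_neg.2 hlt)
      refine ⟨r, h0, h1, fun _ n => (iidPr_mono hw fun P hP => ?_).trans (h n)⟩
      rw [← sub_nonneg, thieleScoreZ_sub] at hP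
      exact_mod_cast hP
    · exact ⟨1 / 2, by norm_num, by norm_num, fun h => absurd h hx⟩
  choose r h0 h1 h using hpair
  obtain ⟨x₀, -, hx₀⟩ := Finset.exists_max_image Finset.univ r Finset.univ_nonempty
  refine ⟨r x₀, (topPairs k p).card + 1, h0 x₀, h1 x₀, by positivity, fun n => ?_⟩
  calc _ ≤ iidPr (iadProb m p) n (fun P => ∃ x ∈ topPairs k p,
          thieleScoreZ s P x.1 ≤ thieleScoreZ s P x.2) :=
        iidPr_mono hw fun P ⟨W, hW, U, hU, hUt, hWU⟩ =>
          ⟨(W, U), by simp [topPairs, hW, hU, hUt], hWU⟩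
    _ ≤ ∑ x ∈ topPairs k p, iidPr (iadProb m p) n
          (fun P => thieleScoreZ s P x.1 ≤ thieleScoreZ s P x.2) :=
        iidPr_exists_le hw (topPairs k p) (fun x P => thieleScoreZ s P x.1 ≤ thieleScoreZ s P x.2)
    _ ≤ ∑ x ∈ topPairs k p, r x₀ ^ n := Finset.sum_le_sum fun x hx =>
        (h x hx n).trans (pow_le_pow_left₀ (h0 x).le (hx₀ x (Finset.mem_univ x)) n)
    _ = (topPairs k p).card * r x₀ ^ n := by rw [Finset.sum_const, nsmul_eq_mul]
    _ ≤ _ := by have := h0 x₀; gcongr; linarith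

theorem exists_one_sub_exp_le_prIAD_resolute (hp : ∀ i, 0 < p i ∧ p i < 1)
    (hmono : ∀ i < k, s i ≤ s (i + 1)) (hnc : ∃ i < k, s i ≠ s (i + 1))
    (hT : (topk m k p).card = 1) :
    ∃ c C : ℝ, 0 < c ∧ 0 < C ∧ ∀ n : ℕ, 1 ≤ n → 1 - C * Real.exp (-(c * n)) ≤
      prIAD m n p (fun P => (thieleWinnersZ m k s P).card = 1) := by
  obtain ⟨W, hW⟩ := Finset.card_eq_one.1 hT
  have hWk : W.card = k := (mem_topk.1 (hW ▸ Finset.mem_singleton_self W : W ∈ topk m k p)).1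
  obtain ⟨r, C, hr0, hr1, hC, h⟩ := exists_iidPr_upset_le hp hmono hnc
  refine ⟨-Real.log r, C, neg_pos.2 (Real.log_neg hr0 hr1), hC, fun n _ => ?_⟩
  have he : Real.exp (-(-Real.log r * n)) = r ^ n := by
    rw [neg_mul, neg_neg, mul_comm, Real.exp_nat_mul, Real.exp_log hr0]
  rw [he, prIAD_eq_iidPr]
  refine (sub_le_sub_left (h n) 1).trans (one_sub_le_iidPr (fun A => (iadProb_pos hp A).le)
    (sum_iadProb p) _ _ fun P hP => ?_)
  simp only [hW, Finset.mem_singleton, exists_eq_left, not_exists, not_and, not_le] at hP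
  refine Finset.card_eq_one.2 ⟨W, Finset.eq_singleton_iff_unique_mem.2 ⟨?_, fun U hU => ?_⟩⟩
  · refine mem_thieleWinnersZ.2 ⟨hWk, fun U hU => ?_⟩
    by_cases hUW : U = W
    · rw [hUW]
    · exact (hP U hU hUW).le
  · rw [mem_thieleWinnersZ] at hU
    by_contra hUW
    exact absurd (hP U hU.1 hUW) (not_lt.2 (hU.2 W hWk))

theorem exists_prIAD_irresolute_le (hp : ∀ i, 0 < p i ∧ p i < 1)
    (hnc : ∃ i < k, s i ≠ s (i + 1)) :
    ∃ C : ℝ, 0 < C ∧ ∀ n : ℕ, 1 ≤ n →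
      prIAD m n p (fun P => 2 ≤ (thieleWinnersZ m k s P).card) ≤ C / √n := by
  obtain ⟨t, htk, ht⟩ := hnc
  have hw : ∀ A, 0 ≤ iadProb m p A := fun A => (iadProb_pos hp A).le
  set T : Finset (Finset (Fin m) × Finset (Fin m)) :=
    Finset.univ.filter fun x => x.1.card = k ∧ x.2.card = k ∧ x.1 ≠ x.2 with hTdef
  have hpair : ∀ x : Finset (Fin m) × Finset (Fin m), ∃ C : ℝ, 0 < C ∧
      (x ∈ T → ∀ n : ℕ, 1 ≤ n → iidPr (iadProb m p) n
        (fun P => thieleScoreZ s P x.1 = thieleScoreZ s P x.2) ≤ C / √n) := fun x => by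
    by_cases hx : x ∈ T
    · simp only [hTdef, Finset.mem_filter, Finset.mem_univ, true_and] at hx
      obtain ⟨A, hA1, hA2⟩ := exists_card_inter_eq hx.1 hx.2.1 hx.2.2 htk
      obtain ⟨C, hC, h⟩ := exists_iidPr_sum_eq_zero_le (iadProb_pos hp) (sum_iadProb p)
        (fun A => s (A ∩ x.1).card - s (A ∩ x.2).card) (a := A) (b := ∅) (by
          simp only [hA1, hA2, Finset.empty_inter, sub_self]
          exact sub_ne_zero.2 ht.symm)
      refine ⟨C, hC, fun _ n hn => (iidPr_mono hw fun P hP => ?_).trans (h n hn)⟩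
      rw [← thieleScoreZ_sub, hP, sub_self]
    · exact ⟨1, one_pos, fun h => absurd h hx⟩
  choose C hC h using hpair
  have hsum : 0 ≤ ∑ x ∈ T, C x := Finset.sum_nonneg fun x _ => (hC x).le
  refine ⟨∑ x ∈ T, C x + 1, by linarith, fun n hn => ?_⟩
  rw [prIAD_eq_iidPr]
  calc _ ≤ iidPr (iadProb m p) n (fun P => ∃ x ∈ T,
          thieleScoreZ s P x.1 = thieleScoreZ s P x.2) := by
        refine iidPr_mono hw fun P hP => ?_
        obtain ⟨W, hW, V, hV, hne⟩ := Finset.one_lt_card.1 hP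
        rw [mem_thieleWinnersZ] at hW hV
        exact ⟨(W, V), by simp [hTdef, hW.1, hV.1, hne],
          le_antisymm (hV.2 W hW.1) (hW.2 V hV.1)⟩
    _ ≤ ∑ x ∈ T, iidPr (iadProb m p) n
          (fun P => thieleScoreZ s P x.1 = thieleScoreZ s P x.2) :=
        iidPr_exists_le hw T (fun x P => thieleScoreZ s P x.1 = thieleScoreZ s P x.2)
    _ ≤ ∑ x ∈ T, C x / √n := Finset.sum_le_sum fun x hx => h x hx n hn
    _ = (∑ x ∈ T, C x) / √n := by rw [Finset.sum_div]
    _ ≤ _ := by gcongr; linarith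

theorem exists_averageDominates_iidPr (hp : ∀ i, 0 < p i ∧ p i < 1)
    (hmono : ∀ i < k, s i ≤ s (i + 1)) (hnc : ∃ i < k, s i ≠ s (i + 1))
    (hT : 2 ≤ (topk m k p).card) :
    ∃ c : ℝ, 0 < c ∧ ∃ N : ℕ, ∀ n, N ≤ n → ∃ W ∈ topk m k p, ∃ V ∈ topk m k p, W ≠ V ∧
      c ≤ iidPr (iadProb m p) n (AverageDominates k s W V) := by
  have hw : ∀ A, 0 ≤ iadProb m p A := fun A => (iadProb_pos hp A).le
  obtain ⟨r, C, hr0, hr1, hC, h⟩ := exists_iidPr_upset_le hp hmono hnc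
  set T := (topk m k p ×ˢ topk m k p).filter fun x => x.1 ≠ x.2 with hTdef
  obtain ⟨N, hN⟩ := exists_pow_lt_of_lt_one (show 0 < 1 / (2 * C) by positivity) hr1
  refine ⟨1 / (2 * (T.card + 1)), by positivity, N, fun n hn => ?_⟩
  have hhalf : C * r ^ n ≤ 1 / 2 := by
    have h1 : r ^ n ≤ 1 / (2 * C) := (pow_le_pow_of_le_one hr0.le hr1.le hn).trans hN.le
    calc C * r ^ n ≤ C * (1 / (2 * C)) := by gcongr
      _ = 1 / 2 := by field_simp
  have hex : 1 / 2 ≤ iidPr (iadProb m p) n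
      (fun P => ∃ x ∈ T, AverageDominates k s x.1 x.2 P) := by
    have hsub : (1 : ℝ) / 2 = 1 - 1 / 2 := by norm_num
    refine (le_sub_comm.1 (((h n).trans hhalf).trans_eq hsub)).trans
      (one_sub_le_iidPr hw (sum_iadProb p) _ _ fun P hP => ?_)
    push Not at hP
    obtain ⟨W, hW, V, hV, hne, hWV⟩ := exists_averageDominates hT
      fun W hW U hU hUt => (hP W hW U hU hUt).le
    exact ⟨(W, V), by simp [hTdef, hW, hV, hne], hWV⟩
  by_contra! hcon
  have hle : ∑ x ∈ T, iidPr (iadProb m p) n (AverageDominates k s x.1 x.2) ≤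
      ∑ x ∈ T, 1 / (2 * ((T.card : ℝ) + 1)) := Finset.sum_le_sum fun x hx => by
    simp only [hTdef, Finset.mem_filter, Finset.mem_product] at hx
    exact (hcon x.1 hx.1.1 x.2 hx.1.2 hx.2).le
  have hun := iidPr_exists_le hw T (n := n) (fun x => AverageDominates k s x.1 x.2)
  rw [Finset.sum_const, nsmul_eq_mul] at hle
  have : (T.card : ℝ) * (1 / (2 * (T.card + 1))) < 1 / 2 := by
    rw [mul_one_div, div_lt_div_iff₀ (by positivity) (by norm_num)]
    linarith
  linarith

theorem exists_le_prIAD_irresolute (hp : ∀ i, 0 < p i ∧ p i < 1)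
    (hmono : ∀ i < k, s i ≤ s (i + 1)) (hnc : ∃ i < k, s i ≠ s (i + 1))
    (hT : 2 ≤ (topk m k p).card) :
    ∃ c : ℝ, 0 < c ∧ ∃ N : ℕ, ∀ n, N ≤ n → c / √n ≤
      prIAD m n p (fun P => 2 ≤ (thieleWinnersZ m k s P).card) := by
  have hw : ∀ A, 0 ≤ iadProb m p A := fun A => (iadProb_pos hp A).le
  obtain ⟨c, hc, N, hN⟩ := exists_averageDominates_iidPr hp hmono hnc hT
  obtain ⟨B, hB⟩ := Finite.exists_le fun x : Finset (Fin m) × Finset (Fin m) =>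
    ∑ A, iadProb m p A * ((s (A ∩ x.1).card - s (A ∩ x.2).card : ℤ) : ℝ) ^ 2
  have hB0 : 0 ≤ B := (Finset.sum_nonneg fun A _ => mul_nonneg (hw A) (sq_nonneg _)).trans
    (hB (∅, ∅))
  obtain ⟨c', hc', hcoll⟩ := exists_div_sqrt_le_iidPr_add_self hw (sum_iadProb p) hB0 hc
  have heven : ∀ l, 1 ≤ l → N ≤ l → c' / √(l : ℝ) ≤ iidPr (iadProb m p) (l + l)
      (fun P => 2 ≤ (thieleWinnersZ m k s P).card) := fun l hl hNl => by
    obtain ⟨W, hW, V, hV, hne, hcW⟩ := hN l hNl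
    obtain ⟨σ, hσW, hσV, hσp⟩ := exists_perm_of_mem_topk hW hV
    refine hcoll σ.finsetCongr (iadProb_finsetCongr hp hσp)
      (fun A => s (A ∩ W).card - s (A ∩ V).card) (fun A => ?_) (hB (W, V)) l hl
      (AverageDominates k s W V) (fun P hP => hP.finsetCongr hσW hσV) hcW _
      fun P Q hP hQ h =>
        hP.two_le_card_append (mem_topk.1 hW).1 (mem_topk.1 hV).1 hne hQ h
    have h1 := card_finsetCongr_inter σ A W
    have h2 := card_finsetCongr_inter σ A V
    rw [hσW] at h1
    rw [hσV] at h2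
    simp only [h1, h2]
    ring
  have hpos := iadProb_pos hp ∅
  have hle1 : iadProb m p ∅ ≤ 1 := by
    rw [← sum_iadProb p]
    exact Finset.single_le_sum (fun A _ => hw A) (Finset.mem_univ _)
  refine ⟨iadProb m p ∅ * c', by positivity, 2 * N + 2, fun n hn => ?_⟩
  rw [prIAD_eq_iidPr]
  obtain ⟨l, hl | hl⟩ := n.even_or_odd'
  · have h := heven l (by omega) (by omega)
    have hl0 : (0 : ℝ) < l := by exact_mod_cast (by omega : 0 < l)
    have hln : (l : ℝ) ≤ n := by exact_mod_cast (by omega : l ≤ n)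
    rw [← two_mul, ← hl] at h
    refine le_trans ?_ h
    gcongr
    exact mul_le_of_le_one_left hc'.le hle1
  · have h := heven l (by omega) (by omega)
    have hl0 : (0 : ℝ) < l := by exact_mod_cast (by omega : 0 < l)
    have hln : (l : ℝ) ≤ n := by exact_mod_cast (by omega : l ≤ n)
    rw [← two_mul] at h
    subst hl
    refine le_trans ?_ (mul_iidPr_le_iidPr_succ hw ∅ _ _ fun P hP => by
      rwa [thieleWinnersZ_cons_empty])
    rw [mul_div_assoc]
    refine mul_le_mul_of_nonneg_left (le_trans ?_ h) hpos.le
    gcongr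

end Profiles

/-- dichotomy for resoluteness of Thiele methods with integer
score vectors under independent approval distributions: if `|top_k(p⃗)| = 1`, the
method is resolute with probability at least `1 − C·e^{−cn}`; otherwise the
probability of irresoluteness is `Θ(1/√n)`. -/
theorem thiele_resolute_dichotomy (m k : ℕ) (hk : 1 ≤ k) (hkm : k ≤ m)
    (p : Fin m → ℝ) (hp : ∀ i, 0 < p i ∧ p i < 1)
    (s : ℕ → ℤ) (hmono : ∀ i < k, s i ≤ s (i + 1))
    (hnc : ∃ i < k, s i ≠ s (i + 1)) :
    ((topk m k p).card = 1 →
      ∃ c C : ℝ, 0 < c ∧ 0 < C ∧ ∀ n : ℕ, 1 ≤ n →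
        1 - C * Real.exp (-(c * n)) ≤
          prIAD m n p (fun P => (thieleWinnersZ m k s P).card = 1)) ∧
    (2 ≤ (topk m k p).card →
      ∃ c₁ c₂ : ℝ, 0 < c₁ ∧ 0 < c₂ ∧ ∃ N : ℕ, ∀ n : ℕ, N ≤ n →
        c₁ / Real.sqrt n ≤
          prIAD m n p (fun P => 2 ≤ (thieleWinnersZ m k s P).card) ∧
        prIAD m n p (fun P => 2 ≤ (thieleWinnersZ m k s P).card) ≤
          c₂ / Real.sqrt n) := by
  refine ⟨exists_one_sub_exp_le_prIAD_resolute hp hmono hnc, fun hT => ?_⟩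
  obtain ⟨c₁, hc₁, N, hN⟩ := exists_le_prIAD_irresolute hp hmono hnc hT
  obtain ⟨c₂, hc₂, h⟩ := exists_prIAD_irresolute_le hp hnc
  exact ⟨c₁, c₂, hc₁, hc₂, max N 1, fun n hn =>
    ⟨hN n ((le_max_left _ _).trans hn), h n ((le_max_right _ _).trans hn)⟩⟩
end
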